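/- arXiv:2207.02772 — 7 statements merged into one kernel-verified Lean document; each statement's English description precedes it below -/
import Mathlib

section
/- For every graph H with at least one edge there exist constants c, T, γ > 0 such that for all sufficiently large n and every integer b with 1 ≤ b < c·n^{1/m(H)}, in the b-Waiter-Client game played on the edge set of the complete H-partite graph K_n^H, Waiter can ensure that, with p = 1/b, Client's final graph G ⊆ K_n^H satisfies all three of: (P1) N_G(H) ≥ γ·n^{v(H)}·p^{e(H)}; (P2) N_G(H') ≤ T·n^{v(H')}·p^{e(H')} for every induced subgraph H' ⊆ H; (P3) N_G(H^J) ≤ T·n^{2v(H)−v(J)}·p^{2e(H)−e(J)} for every induced subgraph J ⊆ H. -/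
/-!
Common definitions:
* A formal model of the `b`-Waiter-Client game on a finite board.
* Complete `H`-partite graphs `K_n^H`, canonical copies of induced subgraphs,
  canonical copies of the overlap graphs `H^J`, and the associated counting functions.
-/

namespace WCGame

variable {X : Type*} [DecidableEq X]

/-- A history of play: the list of rounds so far, each round consisting of the
set of elements offered by Waiter together with the element chosen by Client. -/
abbrev Hist (X : Type*) := List (Finset X × X)

/-- All elements offered so far during a history. -/
def offeredSet (h : Hist X) : Finset X := h.foldr (fun r acc => r.1 ∪ acc) ∅

/-- A Waiter strategy: to every history it assigns either a set of elements to
offer next, or `none`, meaning that Waiter declares the game over. -/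
abbrev WaiterStrategy (X : Type*) := Hist X → Option (Finset X)

/-- A Client strategy: to every history and currently offered set it assigns
the element of that set that Client picks. -/
abbrev ClientStrategy (X : Type*) := Hist X → Finset X → X

/-- A Waiter strategy is legal (for board `board` and parameter `b`) if every
set it offers consists of exactly `b` elements of the board which were not
offered in any previous round.  (Waiter may always stop instead, in particular
when fewer than `b` unoffered elements remain no legal offer exists and a legal
Waiter strategy must stop.) -/
def WaiterLegal (board : Finset X) (b : ℕ) (W : WaiterStrategy X) : Prop :=
  ∀ h O, W h = some O → O.card = b ∧ O ⊆ board ∧ Disjoint O (offeredSet h)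

/-- A Client strategy is legal if it always picks an element of the offered set. -/
def ClientLegal (C : ClientStrategy X) : Prop :=
  ∀ h O, O.Nonempty → C h O ∈ O

/-- Playing the game for at most `fuel` further rounds from a given history. -/
def playAux (W : WaiterStrategy X) (C : ClientStrategy X) : ℕ → Hist X → Hist X
  | 0, h => h
  | fuel + 1, h =>
    match W h with
    | none => h
    | some O => playAux W C fuel (h ++ [(O, C h O)])

/-- Client's final set `S`: the set of all elements chosen by Client during the
whole game.  (For a legal Waiter strategy with `b ≥ 1` the game lasts at most
`board.card` rounds, so the fuel `board.card` never truncates the game.) -/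
def finalSet (board : Finset X) (W : WaiterStrategy X) (C : ClientStrategy X) : Finset X :=
  ((playAux W C board.card []).map Prod.snd).toFinset

/-- Waiter can ensure that Client's final set has property `P` in the
`b`-Waiter-Client game on `board`. -/
def WaiterCanEnsure (board : Finset X) (b : ℕ) (P : Finset X → Prop) : Prop :=
  ∃ W : WaiterStrategy X, WaiterLegal board b W ∧
    ∀ C : ClientStrategy X, ClientLegal C → P (finalSet board W C)

end WCGame

namespace GraphDefs

variable {α : Type*} [Fintype α] [DecidableEq α]

/-- The maximum density `m(H) = max { e(H')/v(H') : H' ⊆ H, v(H') ≥ 1 }`. -/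
noncomputable def maxDensity (H : SimpleGraph α) : ℝ :=
  sSup { d : ℝ | ∃ H' : H.Subgraph, H'.verts.Nonempty ∧
          d = (H'.edgeSet.ncard : ℝ) / (H'.verts.ncard : ℝ) }

/-- The complete `H`-partite graph `K_n^H`: the part `V_a` corresponding to a
vertex `a` of `H` is `{a} × Fin n`, and `(a,i)` is adjacent to `(b,j)` iff
`a` and `b` are adjacent in `H`. -/
def Kpart (H : SimpleGraph α) (n : ℕ) : SimpleGraph (α × Fin n) :=
  SimpleGraph.comap Prod.fst H

/-- Number of edges of the induced subgraph `H[s]`, i.e. edges of `H` with both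
endpoints in `s`. -/
noncomputable def eIn (H : SimpleGraph α) (s : Set α) : ℕ :=
  {e ∈ H.edgeSet | ∀ v ∈ e, v ∈ s}.ncard

/-- Canonical copies of the induced subgraph `H[s]` in `G ⊆ K_n^H`.
A canonical copy is an (automatically injective) edge-preserving map
`a ↦ (a, f a)` sending each vertex `a ∈ s` into its part `V_a`; it is thus
faithfully encoded by the function `f : s → Fin n` of second coordinates. -/
def canonCopies (H : SimpleGraph α) (n : ℕ) (G : SimpleGraph (α × Fin n)) (s : Set α) :
    Set (s → Fin n) :=
  { f | ∀ a b : s, H.Adj a b → G.Adj ((a : α), f a) ((b : α), f b) }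

/-- `N_G(H[s])`: the number of canonical copies of the induced subgraph `H[s]` in `G`. -/
noncomputable def NCopies (H : SimpleGraph α) (n : ℕ) (G : SimpleGraph (α × Fin n))
    (s : Set α) : ℕ :=
  (canonCopies H n G s).ncard

/-- The canonical copy encoded by `f` contains the vertex `(x, u)` of `K_n^H`. -/
def containsVtx {n : ℕ} (s : Set α) (f : s → Fin n) (x : α) (u : Fin n) : Prop :=
  ∃ a : s, (a : α) = x ∧ f a = u

/-- `deg_G(v, H[s])` for the pair of vertices `v = ((x,u),(y,w))`: the number of
canonical copies of `H[s]` in `G` containing both vertices. -/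
noncomputable def degPair (H : SimpleGraph α) (n : ℕ) (G : SimpleGraph (α × Fin n)) (s : Set α)
    (x : α) (u : Fin n) (y : α) (w : Fin n) : ℕ :=
  {f ∈ canonCopies H n G s | containsVtx s f x u ∧ containsVtx s f y w}.ncard

/-- Canonical copies of `H^J` (`J = H[s]`) in `G ⊆ K_n^H`.  A canonical copy of
`H^J` is faithfully encoded by the pair `(f, f')` of (second coordinates of)
canonical copies of `H` given by its restrictions to the two overlapping copies
of `H`; injectivity is equivalent to `f` and `f'` agreeing exactly on `s`. -/
def overlapCopies (H : SimpleGraph α) (n : ℕ) (G : SimpleGraph (α × Fin n)) (s : Set α) :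
    Set ((α → Fin n) × (α → Fin n)) :=
  { ff | (∀ a b : α, H.Adj a b → G.Adj (a, ff.1 a) (b, ff.1 b)) ∧
         (∀ a b : α, H.Adj a b → G.Adj (a, ff.2 a) (b, ff.2 b)) ∧
         (∀ a ∈ s, ff.1 a = ff.2 a) ∧ (∀ a ∉ s, ff.1 a ≠ ff.2 a) }

/-- `N_G(H^J)` for `J = H[s]`: the number of canonical copies of `H^J` in `G`. -/
noncomputable def NOverlap (H : SimpleGraph α) (n : ℕ) (G : SimpleGraph (α × Fin n))
    (s : Set α) : ℕ :=
  (overlapCopies H n G s).ncard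

/-- `deg_G(v, H^J)` for the pair of vertices `v = ((x,u),(y,w))`: the number of
canonical copies of `H^J` in `G` containing both vertices. -/
noncomputable def degPairOverlap (H : SimpleGraph α) (n : ℕ) (G : SimpleGraph (α × Fin n))
    (s : Set α) (x : α) (u : Fin n) (y : α) (w : Fin n) : ℕ :=
  {ff ∈ overlapCopies H n G s | (ff.1 x = u ∨ ff.2 x = u) ∧ (ff.1 y = w ∨ ff.2 y = w)}.ncard

/-- The graph obtained from `Ge` by adding, for each pair `(u,w) ∈ R`, the edge
between `(x,u) ∈ V_x` and `(y,w) ∈ V_y`. -/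
def addPairs {n : ℕ} (Ge : SimpleGraph (α × Fin n)) (x y : α)
    (R : Set (Fin n × Fin n)) : SimpleGraph (α × Fin n) :=
  Ge ⊔ SimpleGraph.fromEdgeSet { p : Sym2 (α × Fin n) | ∃ r ∈ R, p = s((x, r.1), (y, r.2)) }

/-- The edge set of a graph on a finite vertex type, as a finset (the board of
the Waiter-Client game played on the edges of this graph). -/
noncomputable def edgeBoard {β : Type*} (G : SimpleGraph β) [Finite β] : Finset (Sym2 β) :=
  (Set.toFinite G.edgeSet).toFinset

/-- The number of subgraphs of `G` isomorphic to `H`. -/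
noncomputable def copyCount {β : Type*} (G : SimpleGraph β) (H : SimpleGraph α) : ℕ :=
  Set.ncard { G' : G.Subgraph | Nonempty (G'.coe ≃g H) }

end GraphDefs

namespace WCProof
open Finset WCGame

section game
variable {X : Type*} [DecidableEq X]

inductive Ens (b : ℕ) (P : Finset X → Prop) : Finset X → Finset X → Prop
  | halt (F S : Finset X) : P S → Ens b P F S
  | offer (F S O : Finset X) : O ⊆ F → O.card = b →
      (∀ x ∈ O, Ens b P (F \ O) (insert x S)) → Ens b P F S

theorem Ens.mono {b : ℕ} {P : Finset X → Prop} {F S : Finset X} (h : Ens b P F S) :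
    ∀ {F' : Finset X}, F ⊆ F' → Ens b P F' S := by
  induction h with
  | halt F S h => intro F' _; exact Ens.halt _ _ h
  | offer F S O h1 h2 h3 ih =>
    intro F' hF
    exact Ens.offer _ _ O (h1.trans hF) h2
      (fun x hx => ih x hx (sdiff_subset_sdiff hF (le_refl _)))

def cs (h : Hist X) : Finset X := (h.map Prod.snd).toFinset

theorem offeredSet_append (h : Hist X) (r : Finset X × X) :
    offeredSet (h ++ [r]) = offeredSet h ∪ r.1 := by
  induction h with
  | nil => simp [offeredSet]
  | cons a t ih =>
    have : offeredSet (a :: (t ++ [r])) = a.1 ∪ offeredSet (t ++ [r]) := rfl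
    rw [List.cons_append, this, ih]
    have : offeredSet (a :: t) = a.1 ∪ offeredSet t := rfl
    rw [this, union_assoc]

theorem cs_append (h : Hist X) (r : Finset X × X) :
    cs (h ++ [r]) = insert r.2 (cs h) := by
  ext x; simp [cs]

def GoodOffer (b : ℕ) (P : Finset X → Prop) (board : Finset X) (h : Hist X) (O : Finset X) : Prop :=
  O.card = b ∧ O ⊆ board \ offeredSet h ∧
    ∀ x ∈ O, Ens b P ((board \ offeredSet h) \ O) (insert x (cs h))

open scoped Classical in
noncomputable def strat (b : ℕ) (P : Finset X → Prop) (board : Finset X) : WaiterStrategy X :=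
  fun h => if hx : ∃ O, GoodOffer b P board h O then some hx.choose else none

theorem strat_some {b : ℕ} {P : Finset X → Prop} {board : Finset X} {h : Hist X} {O : Finset X}
    (hs : strat b P board h = some O) : GoodOffer b P board h O := by
  unfold strat at hs
  split_ifs at hs with hx
  have := hx.choose_spec
  simp only [Option.some.injEq] at hs
  rwa [hs] at this

theorem strat_none {b : ℕ} {P : Finset X → Prop} {board : Finset X} {h : Hist X}
    (hs : strat b P board h = none) (he : Ens b P (board \ offeredSet h) (cs h)) : P (cs h) := by
  unfold strat at hs
  split_ifs at hs with hx
  cases he with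
  | halt _ _ h => exact h
  | offer _ _ O h1 h2 h3 => exact absurd ⟨O, h2, h1, h3⟩ hx

theorem play_ok {b : ℕ} (hb : 1 ≤ b) {P : Finset X → Prop} {board : Finset X}
    {C : ClientStrategy X} (hC : ClientLegal C) : ∀ (fuel : ℕ) (h : Hist X),
    (board \ offeredSet h).card ≤ fuel → Ens b P (board \ offeredSet h) (cs h) →
    P (cs (playAux (strat b P board) C fuel h)) := by
  intro fuel
  induction fuel with
  | zero =>
    intro h hc he
    simp only [playAux]
    cases he with
    | halt _ _ h => exact h
    | offer _ _ O h1 h2 h3 =>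
      have := card_le_card h1
      omega
  | succ k ih =>
    intro h hc he
    simp only [playAux]
    split
    · next hs => exact strat_none hs he
    · next O hs =>
      obtain ⟨h2, h1, h3⟩ := strat_some hs
      have hne : O.Nonempty := by rw [← card_pos]; omega
      have hmem := hC h O hne
      have e1 : board \ offeredSet (h ++ [(O, C h O)]) = (board \ offeredSet h) \ O := by
        rw [offeredSet_append]; ext; simp; tauto
      apply ih
      · rw [e1, card_sdiff_of_subset h1]; omega
      · rw [e1, cs_append]; exact h3 _ hmem

theorem canEnsure {b : ℕ} (hb : 1 ≤ b) {P : Finset X → Prop} {board : Finset X}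
    (h : Ens b P board ∅) : WaiterCanEnsure board b P := by
  refine ⟨strat b P board, ?_, ?_⟩
  · intro h O hs
    obtain ⟨h2, h1, h3⟩ := strat_some hs
    refine ⟨h2, h1.trans sdiff_subset, ?_⟩
    exact disjoint_of_subset_left h1 sdiff_disjoint
  · intro C hC
    apply play_ok hb hC
    · exact card_le_card sdiff_subset
    · simpa [offeredSet, cs] using h

/-! potential -/

variable {ι : Type*}

def zst (p : ℝ) (S W : Finset X) (e : X) : ℝ := if e ∈ S then 1 else if e ∈ W then p else 0

def Phi (I : Finset ι) (c : ι → ℝ) (A : ι → Finset X) (z : X → ℝ) : ℝ :=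
  ∑ i ∈ I, c i * ∏ e ∈ A i, z e

theorem Phi_mono {I : Finset ι} {c : ι → ℝ} {A : ι → Finset X} (hc : ∀ i, 0 ≤ c i)
    {z z' : X → ℝ} (h0 : ∀ e, 0 ≤ z e) (h : ∀ e, z e ≤ z' e) : Phi I c A z ≤ Phi I c A z' := by
  unfold Phi
  apply sum_le_sum
  intro i _
  exact mul_le_mul_of_nonneg_left (prod_le_prod (fun e _ => h0 e) (fun e _ => h e)) (hc i)

theorem zst_nonneg {p : ℝ} (hp : 0 ≤ p) (S W : Finset X) (e : X) : 0 ≤ zst p S W e := by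
  unfold zst; split_ifs <;> simp [hp]

def wt (I : Finset ι) (c : ι → ℝ) (A : ι → Finset X) (z : X → ℝ) (x : X) : ℝ :=
  ∑ i ∈ I, if x ∈ A i then c i * ∏ e ∈ (A i).erase x, z e else 0

theorem Phi_insert {I : Finset ι} {c : ι → ℝ} {A : ι → Finset X} {p : ℝ} {S W : Finset X} {x : X}
    (hS : x ∉ S) (hW : x ∉ W) :
    Phi I c A (zst p (insert x S) W) = Phi I c A (zst p S W) + wt I c A (zst p S W) x := by
  unfold Phi wt
  rw [← sum_add_distrib]
  apply sum_congr rfl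
  intro i _
  have hz : ∀ e, e ≠ x → zst p (insert x S) W e = zst p S W e := by
    intro e he; simp [zst, he]
  split_ifs with hx
  · rw [← mul_prod_erase _ _ hx, ← mul_prod_erase _ _ hx]
    have : ∏ e ∈ (A i).erase x, zst p (insert x S) W e = ∏ e ∈ (A i).erase x, zst p S W e :=
      prod_congr rfl (fun e he => hz e (ne_of_mem_erase he))
    rw [this]
    simp [zst, hS, hW]
  · rw [add_zero]
    congr 1
    exact prod_congr rfl (fun e he => hz e (fun h => hx (h ▸ he)))

theorem Phi_block {I : Finset ι} {c : ι → ℝ} {A : ι → Finset X} (hc : ∀ i, 0 ≤ c i) {p : ℝ}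
    (hp : 0 ≤ p) {S W B : Finset X} (hS : Disjoint B S) (hW : Disjoint B W) :
    Phi I c A (zst p S W) + p * ∑ x ∈ B, wt I c A (zst p S W) x
      ≤ Phi I c A (zst p S (B ∪ W)) := by
  unfold Phi wt
  rw [sum_comm, mul_sum, ← sum_add_distrib]
  apply sum_le_sum
  intro i _
  have hzB : ∀ e ∈ B, zst p S W e = 0 := by
    intro e he
    simp [zst, disjoint_left.mp hS he, disjoint_left.mp hW he]
  have hzB' : ∀ e ∈ B, zst p S (B ∪ W) e = p := by
    intro e he
    simp [zst, disjoint_left.mp hS he, he]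
  have hz : ∀ e, e ∉ B → zst p S (B ∪ W) e = zst p S W e := by
    intro e he; simp [zst, he]
  have hle : ∀ e, zst p S W e ≤ zst p S (B ∪ W) e := by
    intro e
    by_cases he : e ∈ B
    · rw [hzB e he, hzB' e he]; exact hp
    · rw [hz e he]
  have hmono : ∀ D : Finset X, ∏ e ∈ D, zst p S W e ≤ ∏ e ∈ D, zst p S (B ∪ W) e := fun D =>
    prod_le_prod (fun e _ => zst_nonneg hp _ _ _) (fun e _ => hle e)
  by_cases hone : ∃ x ∈ B, x ∈ A i
  · obtain ⟨x, hxB, hxA⟩ := hone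
    rw [prod_eq_zero hxA (hzB x hxB), mul_zero, zero_add, sum_eq_single_of_mem x hxB]
    · rw [if_pos hxA, ← mul_prod_erase _ _ hxA, hzB' x hxB]
      calc p * (c i * ∏ e ∈ (A i).erase x, zst p S W e)
          = (c i * p) * ∏ e ∈ (A i).erase x, zst p S W e := by ring
        _ ≤ (c i * p) * ∏ e ∈ (A i).erase x, zst p S (B ∪ W) e :=
            mul_le_mul_of_nonneg_left (hmono _) (mul_nonneg (hc i) hp)
        _ = _ := by ring
    · intro y hyB hyx
      split_ifs with hyA
      · rw [prod_eq_zero (mem_erase.mpr ⟨fun h => hyx h.symm, hxA⟩) (hzB x hxB), mul_zero]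
      · rfl
  · push Not at hone
    rw [sum_eq_zero (fun x hx => if_neg (hone x hx)), mul_zero, add_zero]
    exact mul_le_mul_of_nonneg_left (hmono _) (hc i)

theorem round_ok {I : Finset ι} {c : ι → ℝ} {A : ι → Finset X} (hc : ∀ i, 0 ≤ c i) {b : ℕ}
    (hb : 1 ≤ b) {S W B : Finset X} (hS : Disjoint B S) (hW : Disjoint B W)
    (hB : B.card = 2 * b) :
    ∃ O ⊆ B, O.card = b ∧ ∀ x ∈ O, Phi I c A (zst (1 / (b : ℝ)) (insert x S) W) ≤
      Phi I c A (zst (1 / (b : ℝ)) S (B ∪ W)) := by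
  set p : ℝ := 1 / (b : ℝ) with hpdef
  have hbpos : (0 : ℝ) < b := by exact_mod_cast hb
  have hp : 0 ≤ p := by positivity
  set w := wt I c A (zst p S W) with hw
  have hw0 : ∀ x, 0 ≤ w x := by
    intro x
    apply sum_nonneg
    intro i _
    split_ifs
    · exact mul_nonneg (hc i) (prod_nonneg (fun e _ => zst_nonneg hp _ _ _))
    · exact le_refl _
  set s := ∑ x ∈ B, w x with hs
  have hbad : (B.filter (fun x => ¬ (w x ≤ p * s))).card ≤ b := by
    by_contra hcon
    rw [not_le] at hcon
    have hne : (B.filter (fun x => ¬ (w x ≤ p * s))).Nonempty := by rw [← card_pos]; omega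
    have h1 : ∑ x ∈ B.filter (fun x => ¬ (w x ≤ p * s)), p * s <
        ∑ x ∈ B.filter (fun x => ¬ (w x ≤ p * s)), w x := by
      apply sum_lt_sum_of_nonempty hne
      intro x hx
      exact not_le.mp (mem_filter.mp hx).2
    have h2 : ∑ x ∈ B.filter (fun x => ¬ (w x ≤ p * s)), w x ≤ s :=
      sum_le_sum_of_subset_of_nonneg (filter_subset _ _) (fun x _ _ => hw0 x)
    rw [sum_const, nsmul_eq_mul] at h1
    have hs0 : 0 ≤ s := sum_nonneg (fun x _ => hw0 x)
    have h3 : (b : ℝ) * (p * s) ≤ ((B.filter (fun x => ¬ (w x ≤ p * s))).card : ℝ) * (p * s) :=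
      mul_le_mul_of_nonneg_right (by exact_mod_cast hcon.le) (mul_nonneg hp hs0)
    have h4 : (b : ℝ) * (p * s) = s := by rw [hpdef]; field_simp
    linarith
  have hsum := card_filter_add_card_filter_not (s := B) (fun x => w x ≤ p * s)
  have hgood : b ≤ (B.filter (fun x => w x ≤ p * s)).card := by omega
  obtain ⟨O, hO, hOc⟩ := exists_subset_card_eq hgood
  refine ⟨O, hO.trans (filter_subset _ _), hOc, ?_⟩
  intro x hx
  have hx' := mem_filter.mp (hO hx)
  rw [Phi_insert (disjoint_left.mp hS hx'.1) (disjoint_left.mp hW hx'.1)]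
  have := Phi_block (I := I) (A := A) hc hp hS hW
  linarith [hx'.2]

theorem exists_top (d : X → ℝ) (U : Finset X) (k : ℕ) (hk : k ≤ U.card) :
    ∃ B ⊆ U, B.card = k ∧ ∀ x ∈ B, ∀ y ∈ U \ B, d y ≤ d x := by
  induction k with
  | zero => exact ⟨∅, by simp, by simp, by simp⟩
  | succ k ih =>
    obtain ⟨B, hB, hBc, hBd⟩ := ih (by omega)
    have hne : (U \ B).Nonempty := by
      rw [← card_pos, card_sdiff_of_subset hB]; omega
    obtain ⟨m, hm, hmax⟩ := exists_max_image (U \ B) d hne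
    have hm' := mem_sdiff.mp hm
    refine ⟨insert m B, insert_subset hm'.1 hB, by rw [card_insert_of_notMem hm'.2, hBc], ?_⟩
    intro x hx y hy
    simp only [mem_sdiff, mem_insert, not_or] at hy
    have hyU : y ∈ U \ B := mem_sdiff.mpr ⟨hy.1, hy.2.2⟩
    rcases mem_insert.mp hx with rfl | hx
    · exact hmax y hyU
    · exact hBd x hx y hyU

theorem stage {I : Finset ι} {c : ι → ℝ} {A : ι → Finset X} (hc : ∀ i, 0 ≤ c i) {b : ℕ}
    (hb : 1 ≤ b) {P : Finset X → Prop} {W : Finset X} {d : X → ℝ} (hd : ∀ x, 0 ≤ d x) :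
    ∀ (N : ℕ) (U S : Finset X) (t : ℝ), U.card ≤ N → (∀ x ∈ U, d x ≤ t) → 0 ≤ t →
    Disjoint S U → Disjoint U W →
    (∀ S', S ⊆ S' → S' ⊆ S ∪ U →
      (∑ x ∈ U, d x) - 2 * b * t ≤ 2 * b * ∑ x ∈ S' \ S, d x →
      Phi I c A (zst (1 / (b : ℝ)) S' W) ≤ Phi I c A (zst (1 / (b : ℝ)) S (U ∪ W)) →
      Ens b P W S') →
    Ens b P (U ∪ W) S := by
  intro N
  have hbpos : (0 : ℝ) < b := by exact_mod_cast hb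
  have hp : (0 : ℝ) ≤ 1 / (b : ℝ) := by positivity
  induction N with
  | zero =>
    intro U S t hU hdt ht hSU hUW hk
    have : U = ∅ := by rw [← card_eq_zero]; omega
    subst this
    rw [empty_union] at hk ⊢
    exact hk S (le_refl _) (by simp) (by simp; positivity) (le_refl _)
  | succ N ih =>
    intro U S t hU hdt ht hSU hUW hk
    by_cases hsmall : U.card < 2 * b
    · refine (hk S (le_refl _) subset_union_left ?_ ?_).mono subset_union_right
      · have h1 : ∑ x ∈ U, d x ≤ U.card * t := by
          have := sum_le_sum hdt
          rwa [sum_const, nsmul_eq_mul] at this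
        have h2 : (U.card : ℝ) ≤ 2 * b := by exact_mod_cast hsmall.le
        have h3 : (U.card : ℝ) * t ≤ 2 * b * t := mul_le_mul_of_nonneg_right h2 ht
        simp only [sdiff_self, sum_empty, Finset.bot_eq_empty]
        linarith
      · apply Phi_mono hc (zst_nonneg hp _ _)
        intro e
        unfold zst
        by_cases h1 : e ∈ S <;> by_cases h2 : e ∈ W <;> by_cases h3 : e ∈ U <;> simp [h1, h2, h3]
    · push Not at hsmall
      obtain ⟨B, hBU, hBc, hBd⟩ := exists_top d U (2 * b) hsmall
      have hBne : B.Nonempty := by rw [← card_pos]; omega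
      obtain ⟨m, hm, hmin⟩ := exists_min_image B d hBne
      have hUB : Disjoint B (U \ B ∪ W) := by
        rw [disjoint_union_right]
        exact ⟨disjoint_sdiff, disjoint_of_subset_left hBU hUW⟩
      have hBS : Disjoint B S := disjoint_of_subset_left hBU hSU.symm
      obtain ⟨O, hOB, hOc, hO⟩ := round_ok (I := I) (A := A) hc hb hBS hUB hBc
      have hUe : B ∪ (U \ B ∪ W) = U ∪ W := by
        rw [← union_assoc, union_sdiff_of_subset hBU]
      rw [hUe] at hO
      refine Ens.offer _ _ O ((hOB.trans hBU).trans subset_union_left) hOc ?_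
      intro x hx
      have hxB := hOB hx
      have hsub : U \ B ∪ W ⊆ (U ∪ W) \ O := by
        intro y hy
        have hyB : y ∉ B := fun h => disjoint_left.mp hUB h hy
        refine mem_sdiff.mpr ⟨?_, fun h => hyB (hOB h)⟩
        rw [← hUe]; exact mem_union_right _ hy
      refine Ens.mono ?_ hsub
      apply ih (U \ B) (insert x S) (d m)
      · rw [card_sdiff_of_subset hBU]; omega
      · intro y hy; exact hBd m hm y hy
      · exact hd m
      · rw [disjoint_insert_left]
        exact ⟨fun h => (mem_sdiff.mp h).2 hxB, disjoint_of_subset_right sdiff_subset hSU⟩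
      · exact disjoint_of_subset_left sdiff_subset hUW
      · intro S' hS1 hS2 hS3 hS4
        have hxS : x ∉ S := disjoint_left.mp hBS hxB
        apply hk S' ((subset_insert _ _).trans hS1)
        · intro y hy
          have := hS2 hy
          simp only [mem_union, mem_insert, mem_sdiff] at this ⊢
          rcases this with (rfl | h) | h
          · exact Or.inr (hBU hxB)
          · exact Or.inl h
          · exact Or.inr h.1
        · have e1 : S' \ S = insert x (S' \ insert x S) := by
            ext y
            simp only [mem_sdiff, mem_insert]
            by_cases hy : y = x
            · subst hy; simp [hxS, hS1 (mem_insert_self _ _)]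
            · simp [hy]
          rw [e1, sum_insert (by simp)]
          have h1 : ∑ y ∈ B, d y ≤ 2 * b * t := by
            have := sum_le_sum (fun y hy => hdt y (hBU hy) : ∀ y ∈ B, d y ≤ t)
            rw [sum_const, nsmul_eq_mul, hBc] at this
            push_cast at this
            exact this
          have h2 := sum_sdiff (f := d) hBU
          have h3 : 2 * (b : ℝ) * d m ≤ 2 * b * d x :=
            mul_le_mul_of_nonneg_left (hmin x hxB) (by positivity)
          rw [mul_add]
          linarith
        · exact hS4.trans (hO x hx)

end game

section graph
variable {α : Type*} [Fintype α] [DecidableEq α] {n : ℕ}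

def cp (f : α → Fin n) (e : Sym2 α) : Sym2 (α × Fin n) := e.map (fun a => (a, f a))

omit [Fintype α] [DecidableEq α] in
theorem map_cp (f : α → Fin n) (e : Sym2 α) : (cp f e).map Prod.fst = e := by
  unfold cp
  rw [Sym2.map_map]
  exact Sym2.map_id' ▸ rfl

omit [Fintype α] [DecidableEq α] in
theorem cp_inj {f f' : α → Fin n} {e e' : Sym2 α} (h : cp f e = cp f' e') : e = e' := by
  rw [← map_cp f e, h, map_cp]

omit [Fintype α] [DecidableEq α] in
theorem cp_eq {f f' : α → Fin n} {e : Sym2 α} (h : cp f e = cp f' e) : ∀ a ∈ e, f a = f' a := by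
  intro a ha
  have h1 : (a, f a) ∈ cp f e := Sym2.mem_map.mpr ⟨a, ha, rfl⟩
  rw [h] at h1
  obtain ⟨a', _, h2⟩ := Sym2.mem_map.mp h1
  simp only [Prod.mk.injEq] at h2
  rw [← h2.2, h2.1]

open scoped Classical in
noncomputable def loc (L : Finset (Sym2 α)) (J : Finset α) : Finset (Sym2 α) :=
  L.filter (fun e => ∀ a ∈ e, a ∈ J)

theorem mem_loc {L : Finset (Sym2 α)} {J : Finset α} {e : Sym2 α} :
    e ∈ loc L J ↔ e ∈ L ∧ ∀ a ∈ e, a ∈ J := by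
  unfold loc; simp

def agr (ff : (α → Fin n) × (α → Fin n)) : Finset α := univ.filter (fun a => ff.1 a = ff.2 a)

def img (L : Finset (Sym2 α)) (ff : (α → Fin n) × (α → Fin n)) : Finset (Sym2 (α × Fin n)) :=
  L.image (cp ff.1) ∪ L.image (cp ff.2)

theorem card_img (L : Finset (Sym2 α)) (ff : (α → Fin n) × (α → Fin n)) :
    2 * L.card - (loc L (agr ff)).card ≤ (img L ff).card := by
  have h1 := card_union_add_card_inter (L.image (cp ff.1)) (L.image (cp ff.2))
  have h2 : ∀ f : α → Fin n, (L.image (cp f)).card = L.card := fun f =>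
    card_image_of_injective _ (fun _ _ h => cp_inj h)
  rw [h2, h2] at h1
  have h3 : L.image (cp ff.1) ∩ L.image (cp ff.2) ⊆ (loc L (agr ff)).image (cp ff.1) := by
    intro x hx
    obtain ⟨hx1, hx2⟩ := mem_inter.mp hx
    obtain ⟨e, he, rfl⟩ := mem_image.mp hx1
    obtain ⟨e', he', h⟩ := mem_image.mp hx2
    have : e' = e := cp_inj h
    subst this
    refine mem_image_of_mem _ (mem_loc.mpr ⟨he, ?_⟩)
    intro a ha
    simp only [agr, mem_filter, mem_univ, true_and]
    exact (cp_eq h a ha).symm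
  have h4 := (card_le_card h3).trans card_image_le
  unfold img
  omega

theorem card_pairs (J : Finset α) :
    ((univ : Finset ((α → Fin n) × (α → Fin n))).filter (fun ff => agr ff = J)).card
      ≤ n ^ (2 * Fintype.card α - J.card) := by
  have hJ : J.card ≤ Fintype.card α := card_le_univ J
  have hcard : (univ : Finset ((α → Fin n) × ({a // a ∉ J} → Fin n))).card
      = n ^ (2 * Fintype.card α - J.card) := by
    rw [card_univ, Fintype.card_prod, Fintype.card_fun, Fintype.card_fun, Fintype.card_fin,
      Fintype.card_subtype_compl, Fintype.card_coe, ← pow_add]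
    congr 1; omega
  rw [← hcard]
  apply card_le_card_of_injOn (fun ff => (ff.1, fun a => ff.2 a.1)) (fun _ _ => mem_univ _)
  rintro ⟨f, f'⟩ h ⟨g, g'⟩ h' heq
  simp only [coe_filter, mem_univ, true_and, Set.mem_ofPred_eq] at h h'
  simp only [Prod.mk.injEq] at heq
  obtain ⟨h1, h2⟩ := heq
  subst h1
  congr 1
  ext1 a
  by_cases ha : a ∈ J
  · have e1 : a ∈ agr (f, f') := h ▸ ha
    have e2 : a ∈ agr (f, g') := h' ▸ ha
    simp only [agr, mem_filter, mem_univ, true_and] at e1 e2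
    rw [← e1, e2]
  · exact congrFun h2 ⟨a, ha⟩

noncomputable def tgt (n b : ℕ) (L : Finset (Sym2 α)) (J : Finset α) : ℝ :=
  (n : ℝ) ^ (2 * Fintype.card α - J.card) * (1 / (b : ℝ)) ^ (2 * L.card - (loc L J).card)

theorem tgt_pos {b : ℕ} (hn : 1 ≤ n) (hb : 1 ≤ b) (L : Finset (Sym2 α)) (J : Finset α) :
    0 < tgt n b L J := by
  have : (0 : ℝ) < n := by exact_mod_cast hn
  have : (0 : ℝ) < b := by exact_mod_cast hb
  unfold tgt; positivity

abbrev Idx (α : Type*) (n : ℕ) := (Finset (Sym2 α) × Finset α) × ((α → Fin n) × (α → Fin n))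

def Is (EH : Finset (Sym2 α)) (n : ℕ) : Finset (Idx α n) :=
  ((EH.powerset ×ˢ univ) ×ˢ univ).filter (fun i => agr i.2 = i.1.2)

noncomputable def cI (b : ℕ) (i : Idx α n) : ℝ := 1 / tgt n b i.1.1 i.1.2

def AI (i : Idx α n) : Finset (Sym2 (α × Fin n)) := img i.1.1 i.2

noncomputable def Psi (EH : Finset (Sym2 α)) (n b : ℕ) (S W : Finset (Sym2 (α × Fin n))) : ℝ :=
  Phi (Is EH n) (cI b) AI (zst (1 / (b : ℝ)) S W)

def Qc (L : Finset (Sym2 α)) (J : Finset α) (S : Finset (Sym2 (α × Fin n))) : ℕ :=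
  (univ.filter (fun ff : (α → Fin n) × (α → Fin n) => agr ff = J ∧ img L ff ⊆ S)).card

theorem cI_nonneg {b : ℕ} (i : Idx α n) : 0 ≤ cI b i := by
  unfold cI tgt; positivity

theorem Qc_le {EH L : Finset (Sym2 α)} {b : ℕ} (hn : 1 ≤ n) (hb : 1 ≤ b) (hL : L ⊆ EH)
    (J : Finset α) (S W : Finset (Sym2 (α × Fin n))) {T : ℝ} (h : Psi EH n b S W ≤ T) :
    (Qc L J S : ℝ) ≤ T * tgt n b L J := by
  rw [← div_le_iff₀ (tgt_pos hn hb L J)]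
  refine le_trans ?_ h
  unfold Psi Phi
  have hp : (0 : ℝ) ≤ 1 / (b : ℝ) := by positivity
  set M := (univ.filter (fun ff : (α → Fin n) × (α → Fin n) => agr ff = J ∧ img L ff ⊆ S)) with hM
  have hsub : M.image (fun ff => (((L, J), ff) : Idx α n)) ⊆ Is EH n := by
    intro i hi
    obtain ⟨ff, hff, rfl⟩ := mem_image.mp hi
    simp only [hM, mem_filter, mem_univ, true_and] at hff
    simp [Is, hL, hff.1]
  refine le_trans ?_ (sum_le_sum_of_subset_of_nonneg hsub ?_)
  · rw [sum_image (by intro a _ b _ h; simpa using h)]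
    have : ∀ ff ∈ M, 1 / tgt n b L J = cI b (((L, J), ff) : Idx α n) *
        ∏ e ∈ AI (((L, J), ff) : Idx α n), zst (1 / (b : ℝ)) S W e := by
      intro ff hff
      simp only [hM, mem_filter, mem_univ, true_and] at hff
      rw [prod_eq_one, mul_one]
      · rfl
      · intro e he
        simp [zst, hff.2 he]
    rw [← sum_congr rfl this, sum_const, nsmul_eq_mul]
    apply le_of_eq
    change (M.card : ℝ) / _ = _
    ring
  · intro i _ _
    exact mul_nonneg (cI_nonneg i) (prod_nonneg (fun e _ => zst_nonneg hp _ _ _))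

noncomputable def TT (EH : Finset (Sym2 α)) : ℝ :=
  ((EH.powerset ×ˢ (univ : Finset (Finset α))).card : ℝ)

theorem Psi_init {EH : Finset (Sym2 α)} {b : ℕ} (hn : 1 ≤ n) (hb : 1 ≤ b)
    (W : Finset (Sym2 (α × Fin n))) : Psi EH n b ∅ W ≤ TT EH := by
  have hbpos : (0 : ℝ) < b := by exact_mod_cast hb
  have hp : (0 : ℝ) ≤ 1 / (b : ℝ) := by positivity
  have hp1 : 1 / (b : ℝ) ≤ 1 := by
    rw [div_le_one hbpos]; exact_mod_cast hb
  unfold Psi Phi Is TT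
  rw [sum_filter, sum_product]
  rw [card_eq_sum_ones]
  push_cast
  apply sum_le_sum
  rintro ⟨L, J⟩ _
  rw [← sum_filter]
  have h1 : ∀ ff ∈ univ.filter (fun ff : (α → Fin n) × (α → Fin n) => agr ff = J),
      cI b (((L, J), ff) : Idx α n) *
        ∏ e ∈ AI (((L, J), ff) : Idx α n), zst (1 / (b : ℝ)) ∅ W e ≤
      1 / tgt n b L J * (1 / (b : ℝ)) ^ (2 * L.card - (loc L J).card) := by
    intro ff hff
    simp only [mem_filter, mem_univ, true_and] at hff
    apply mul_le_mul_of_nonneg_left _ (cI_nonneg (((L, J), ff) : Idx α n))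
    calc ∏ e ∈ AI (((L, J), ff) : Idx α n), zst (1 / (b : ℝ)) ∅ W e
        ≤ ∏ e ∈ AI (((L, J), ff) : Idx α n), (1 / (b : ℝ)) := by
          apply prod_le_prod (fun e _ => zst_nonneg hp _ _ _)
          intro e _
          unfold zst
          simp only [notMem_empty, if_false]
          split_ifs
          · exact le_refl _
          · exact hp
      _ = (1 / (b : ℝ)) ^ (img L ff).card := by rw [prod_const]; rfl
      _ ≤ _ := by
          apply pow_le_pow_of_le_one hp hp1
          have := card_img L ff
          rwa [hff] at this
  refine (sum_le_sum h1).trans ?_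
  rw [sum_const, nsmul_eq_mul]
  have h2 := card_pairs (n := n) J
  have h2' : (((univ : Finset ((α → Fin n) × (α → Fin n))).filter (fun ff => agr ff = J)).card : ℝ)
      ≤ (n : ℝ) ^ (2 * Fintype.card α - J.card) := by exact_mod_cast h2
  have ht := tgt_pos hn hb L J
  calc _ ≤ (n : ℝ) ^ (2 * Fintype.card α - J.card) *
        (1 / tgt n b L J * (1 / (b : ℝ)) ^ (2 * L.card - (loc L J).card)) :=
        mul_le_mul_of_nonneg_right h2' (by positivity)
    _ = tgt n b L J / tgt n b L J := by unfold tgt; ring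
    _ = 1 := div_self ht.ne'

/-- number of canonical copies of the spanning subgraph with edges `L` -/
def Nc (L : Finset (Sym2 α)) (S : Finset (Sym2 (α × Fin n))) : ℕ :=
  (univ.filter (fun f : α → Fin n => L.image (cp f) ⊆ S)).card

def dg (L : Finset (Sym2 α)) (S : Finset (Sym2 (α × Fin n))) (e : Sym2 α)
    (x : Sym2 (α × Fin n)) : ℕ :=
  ((univ.filter (fun f : α → Fin n => L.image (cp f) ⊆ S)).filter (fun f => cp f e = x)).card

def Eb (n : ℕ) (e : Sym2 α) : Finset (Sym2 (α × Fin n)) :=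
  univ.filter (fun x => x.map Prod.fst = e)

def Wb (n : ℕ) (R : Finset (Sym2 α)) : Finset (Sym2 (α × Fin n)) :=
  univ.filter (fun x => x.map Prod.fst ∈ R)

theorem cp_mem_Eb (f : α → Fin n) (e : Sym2 α) : cp f e ∈ Eb n e := by
  simp [Eb, map_cp]

theorem sum_dg (L : Finset (Sym2 α)) (S : Finset (Sym2 (α × Fin n))) (e : Sym2 α) :
    ∑ x ∈ Eb n e, dg L S e x = Nc L S := by
  unfold dg Nc
  exact (card_eq_sum_card_fiberwise (fun f _ => cp_mem_Eb f e)).symm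

theorem sum_dg_le {L : Finset (Sym2 α)} {S S' : Finset (Sym2 (α × Fin n))} {e : Sym2 α}
    (hS : S ⊆ S') : ∑ x ∈ S' \ S, dg L S e x ≤ Nc (insert e L) S' := by
  have h := card_eq_sum_card_fiberwise (s := univ.filter (fun f : α → Fin n =>
    L.image (cp f) ⊆ S ∧ cp f e ∈ S' \ S)) (t := S' \ S) (f := fun f => cp f e) (by
      intro f hf
      have := (mem_filter.mp hf).2.2
      exact this)
  have h2 : ∑ x ∈ S' \ S, dg L S e x = ∑ x ∈ S' \ S, ((univ.filter (fun f : α → Fin n =>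
    L.image (cp f) ⊆ S ∧ cp f e ∈ S' \ S)).filter (fun f => cp f e = x)).card := by
    apply sum_congr rfl
    intro x hx
    unfold dg
    congr 1
    ext f
    simp only [mem_filter, mem_univ, true_and]
    constructor
    · rintro ⟨h1, rfl⟩; exact ⟨⟨h1, hx⟩, rfl⟩
    · rintro ⟨⟨h1, _⟩, h2⟩; exact ⟨h1, h2⟩
  rw [h2, ← h]
  unfold Nc
  apply card_le_card
  intro f hf
  simp only [mem_filter, mem_univ, true_and] at hf ⊢
  rw [image_insert]
  exact insert_subset (mem_sdiff.mp hf.2).1 (hf.1.trans hS)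

open scoped Classical in
theorem sum_dg_sq (L : Finset (Sym2 α)) (S : Finset (Sym2 (α × Fin n))) (e : Sym2 α) :
    ∑ x ∈ Eb n e, (dg L S e x) ^ 2 ≤
      ∑ J ∈ (univ : Finset (Finset α)).filter (fun J => ∀ a ∈ e, a ∈ J), Qc L J S := by
  set A := (univ.filter (fun f : α → Fin n => L.image (cp f) ⊆ S)) with hA
  set Z := (A ×ˢ A).filter (fun ff => cp ff.1 e = cp ff.2 e) with hZ
  have h1 : ∑ x ∈ Eb n e, (dg L S e x) ^ 2 = Z.card := by
    rw [card_eq_sum_card_fiberwise (s := Z) (t := Eb n e) (f := fun ff => cp ff.1 e)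
      (fun ff _ => cp_mem_Eb ff.1 e)]
    apply sum_congr rfl
    intro x _
    unfold dg
    rw [sq, ← card_product]
    congr 1
    ext ⟨f, f'⟩
    simp only [hZ, mem_filter, mem_product, ← hA]
    constructor
    · rintro ⟨⟨h1, h2⟩, h3, h4⟩; exact ⟨⟨⟨h1, h3⟩, h2.trans h4.symm⟩, h2⟩
    · rintro ⟨⟨⟨h1, h2⟩, h3⟩, h4⟩; exact ⟨⟨h1, h4⟩, h2, h3 ▸ h4⟩
  rw [h1, card_eq_sum_card_fiberwise (s := Z) (f := agr)
    (t := (univ : Finset (Finset α)).filter (fun J => ∀ a ∈ e, a ∈ J))]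
  · apply sum_le_sum
    intro J _
    apply card_le_card
    rintro ⟨f, f'⟩ hff
    simp only [hZ, hA, mem_filter, mem_product, mem_univ, true_and] at hff ⊢
    exact ⟨hff.2, union_subset hff.1.1.1 hff.1.1.2⟩
  · rintro ⟨f, f'⟩ hff
    have h2 := (mem_filter.mp hff).2
    refine mem_coe.mpr (mem_filter.mpr ⟨mem_univ _, ?_⟩)
    intro a ha
    simp only [agr, mem_filter, mem_univ, true_and]
    exact cp_eq h2 a ha

theorem tgt_le {L EH : Finset (Sym2 α)} {J : Finset α} {e : Sym2 α} {b : ℕ} {c : ℝ}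
    (hb : 1 ≤ b) (hL : L ⊆ EH) (heE : e ∈ EH) (heL : e ∉ L)
    (heJ : ∀ a ∈ e, a ∈ J)
    (hdens : (b : ℝ) ^ (loc EH J).card ≤ c * (n : ℝ) ^ J.card) :
    tgt n b L J ≤ ((n : ℝ) ^ (Fintype.card α) * (1 / (b : ℝ)) ^ L.card) ^ 2 * (c * (1 / (b : ℝ))) := by
  have hbpos : (0 : ℝ) < b := by exact_mod_cast hb
  have hb1 : (1 : ℝ) ≤ b := by exact_mod_cast hb
  have hlt : (loc L J).card + 1 ≤ (loc EH J).card := by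
    have hne : e ∉ loc L J := fun h => heL (mem_loc.mp h).1
    rw [← card_insert_of_notMem hne]
    apply card_le_card
    apply insert_subset (mem_loc.mpr ⟨heE, heJ⟩)
    intro x hx
    exact mem_loc.mpr ⟨hL (mem_loc.mp hx).1, (mem_loc.mp hx).2⟩
  have h1 : (b : ℝ) ^ ((loc L J).card + 1) ≤ c * (n : ℝ) ^ J.card :=
    (pow_le_pow_right₀ hb1 hlt).trans hdens
  have h2 : 1 ≤ c * (n : ℝ) ^ J.card * (1 / (b : ℝ)) ^ ((loc L J).card + 1) := by
    rw [one_div, inv_pow, ← div_eq_mul_inv, one_le_div (by positivity)]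
    exact h1
  have hJ : J.card ≤ Fintype.card α := card_le_univ J
  have hlL : (loc L J).card ≤ L.card := card_le_card (fun x hx => (mem_loc.mp hx).1)
  have h3 : tgt n b L J * (n : ℝ) ^ J.card * (1 / (b : ℝ)) ^ (loc L J).card
      = ((n : ℝ) ^ (Fintype.card α) * (1 / (b : ℝ)) ^ L.card) ^ 2 := by
    unfold tgt
    have e1 : (n : ℝ) ^ (2 * Fintype.card α - J.card) * (n : ℝ) ^ J.card
        = ((n : ℝ) ^ (Fintype.card α)) ^ 2 := by
      rw [← pow_add, ← pow_mul]; congr 1; omega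
    have e2 : (1 / (b : ℝ)) ^ (2 * L.card - (loc L J).card) * (1 / (b : ℝ)) ^ (loc L J).card
        = ((1 / (b : ℝ)) ^ L.card) ^ 2 := by
      rw [← pow_add, ← pow_mul]; congr 1; omega
    rw [mul_pow, ← e1, ← e2]; ring
  have h0 : 0 ≤ tgt n b L J := by unfold tgt; positivity
  calc tgt n b L J = tgt n b L J * 1 := (mul_one _).symm
    _ ≤ tgt n b L J * (c * (n : ℝ) ^ J.card * (1 / (b : ℝ)) ^ ((loc L J).card + 1)) :=
        mul_le_mul_of_nonneg_left h2 h0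
    _ = (tgt n b L J * (n : ℝ) ^ J.card * (1 / (b : ℝ)) ^ (loc L J).card) * (c * (1 / (b : ℝ))) := by
        rw [pow_succ]; ring
    _ = _ := by rw [h3]

theorem TT_pos (EH : Finset (Sym2 α)) : 1 ≤ TT EH := by
  unfold TT
  have : 0 < (EH.powerset ×ˢ (univ : Finset (Finset α))).card := by
    rw [card_pos]
    exact ⟨(∅, ∅), by simp⟩
  exact_mod_cast this

noncomputable def cc (EH : Finset (Sym2 α)) : ℝ :=
  ((1 / 4 : ℝ) ^ EH.card) ^ 2 / (32 * 2 ^ (Fintype.card α) * TT EH)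

theorem main_ens {EH : Finset (Sym2 α)} {b : ℕ} (hn : 1 ≤ n) (hb : 1 ≤ b)
    (hdens : ∀ J : Finset α, (∃ e ∈ EH, ∀ a ∈ e, a ∈ J) →
      (b : ℝ) ^ (loc EH J).card ≤ cc EH * (n : ℝ) ^ J.card) :
    ∀ (k : ℕ) (L : Finset (Sym2 α)) (S : Finset (Sym2 (α × Fin n))), (EH \ L).card = k → L ⊆ EH →
      Disjoint S (Wb n (EH \ L)) → Psi EH n b S (Wb n (EH \ L)) ≤ TT EH →
      (1 / 4 : ℝ) ^ L.card * ((n : ℝ) ^ (Fintype.card α) * (1 / (b : ℝ)) ^ L.card) ≤ Nc L S →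
      Ens b (fun S => Psi EH n b S ∅ ≤ TT EH ∧
        (1 / 4 : ℝ) ^ EH.card * ((n : ℝ) ^ (Fintype.card α) * (1 / (b : ℝ)) ^ EH.card) ≤ Nc EH S)
        (Wb n (EH \ L)) S := by
  have hbpos : (0 : ℝ) < b := by exact_mod_cast hb
  have hnpos : (0 : ℝ) < n := by exact_mod_cast hn
  intro k
  induction k with
  | zero =>
    intro L S hk hL hdis hPsi hN
    have h0 : EH \ L = ∅ := card_eq_zero.mp hk
    have hE : L = EH := subset_antisymm hL (sdiff_eq_empty_iff_subset.mp h0)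
    subst hE
    apply Ens.halt
    refine ⟨?_, hN⟩
    have : Wb n (L \ L) = (∅ : Finset (Sym2 (α × Fin n))) := by simp [Wb]
    rwa [this] at hPsi
  | succ k ih =>
    intro L S hk hL hdis hPsi hN
    have hne : (EH \ L).Nonempty := by rw [← card_pos]; omega
    obtain ⟨e, he⟩ := hne
    obtain ⟨heE, heL⟩ := mem_sdiff.mp he
    have hW : Wb n (EH \ L) = Eb n e ∪ Wb n (EH \ insert e L) := by
      ext x
      simp only [Wb, Eb, mem_filter, mem_univ, true_and, mem_union, mem_sdiff, mem_insert]
      by_cases hx : x.map Prod.fst = e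
      · simp [hx, heE, heL]
      · simp [hx]
    have hEW : Disjoint (Eb n e) (Wb n (EH \ insert e L)) := by
      rw [disjoint_left]
      intro x hx hx'
      simp only [Wb, Eb, mem_filter, mem_univ, true_and, mem_sdiff, mem_insert] at hx hx'
      exact hx'.2 (Or.inl hx)
    set p : ℝ := 1 / (b : ℝ) with hp
    have hppos : 0 < p := by positivity
    have hbp : b * p = 1 := by rw [hp]; field_simp
    set μ : ℝ := (n : ℝ) ^ (Fintype.card α) * p ^ L.card with hμ
    have hμpos : 0 < μ := by positivity
    set g : ℝ := (1 / 4 : ℝ) ^ L.card with hg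
    have hgpos : 0 < g := by positivity
    set t : ℝ := g / 8 * μ * p with ht
    have htpos : 0 < t := by positivity
    have hT := TT_pos EH
    have hTpos : 0 < TT EH := by linarith
    -- second moment
    have hsq : (∑ x ∈ Eb n e, ((dg L S e x : ℕ) : ℝ) ^ 2) ≤ g ^ 2 / 32 * (μ ^ 2 * p) := by
      classical
      have h1 : (∑ x ∈ Eb n e, ((dg L S e x : ℕ) : ℝ) ^ 2) ≤
        ∑ J ∈ (univ : Finset (Finset α)).filter (fun J => ∀ a ∈ e, a ∈ J), (Qc L J S : ℝ) := by
        have := sum_dg_sq L S e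
        exact_mod_cast this
      refine h1.trans ?_
      have h2 : ∀ J ∈ (univ : Finset (Finset α)).filter (fun J => ∀ a ∈ e, a ∈ J),
          (Qc L J S : ℝ) ≤ TT EH * (μ ^ 2 * (cc EH * p)) := by
        intro J hJ
        have hJ' := (mem_filter.mp hJ).2
        refine (Qc_le hn hb hL J S _ hPsi).trans ?_
        exact mul_le_mul_of_nonneg_left
          (tgt_le hb hL heE heL hJ' (hdens J ⟨e, heE, hJ'⟩)) hTpos.le
      refine (sum_le_sum h2).trans ?_
      rw [sum_const, nsmul_eq_mul]
      have hccpos : 0 < cc EH := by unfold cc; positivity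
      have h3 : (((univ : Finset (Finset α)).filter (fun J => ∀ a ∈ e, a ∈ J)).card : ℝ)
          ≤ 2 ^ Fintype.card α := by
        have := card_le_univ ((univ : Finset (Finset α)).filter (fun J => ∀ a ∈ e, a ∈ J))
        rw [Fintype.card_finset] at this
        exact_mod_cast this
      have h4 : (2 : ℝ) ^ Fintype.card α * (TT EH * cc EH) = ((1 / 4 : ℝ) ^ EH.card) ^ 2 / 32 := by
        unfold cc; field_simp
      have h5 : (1 / 4 : ℝ) ^ EH.card ≤ g :=
        pow_le_pow_of_le_one (by norm_num) (by norm_num) (card_le_card hL)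
      have h6 : ((1 / 4 : ℝ) ^ EH.card) ^ 2 ≤ g ^ 2 := pow_le_pow_left₀ (by positivity) h5 2
      calc _ ≤ (2 : ℝ) ^ Fintype.card α * (TT EH * (μ ^ 2 * (cc EH * p))) :=
            mul_le_mul_of_nonneg_right h3 (by positivity)
        _ = (2 : ℝ) ^ Fintype.card α * (TT EH * cc EH) * (μ ^ 2 * p) := by ring
        _ = ((1 / 4 : ℝ) ^ EH.card) ^ 2 / 32 * (μ ^ 2 * p) := by rw [h4]
        _ ≤ _ := mul_le_mul_of_nonneg_right (by linarith) (by positivity)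
    set d : Sym2 (α × Fin n) → ℝ := fun x => if (dg L S e x : ℝ) ≤ t then (dg L S e x : ℝ) else 0
      with hd
    have hd0 : ∀ x, 0 ≤ d x := by
      intro x; simp only [hd]; split_ifs <;> positivity
    have hdt : ∀ x, d x ≤ t := by
      intro x; simp only [hd]; split_ifs with h
      · exact h
      · exact htpos.le
    have hdle : ∀ x, d x ≤ dg L S e x := by
      intro x; simp only [hd]; split_ifs with h
      · exact le_refl _
      · positivity
    have hdsum : g * μ * (3 / 4) ≤ ∑ x ∈ Eb n e, d x := by
      have h1 : ∀ x ∈ Eb n e, (dg L S e x : ℝ) - (dg L S e x : ℝ) ^ 2 / t ≤ d x := by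
        intro x _
        simp only [hd]
        split_ifs with h
        · have : 0 ≤ (dg L S e x : ℝ) ^ 2 / t := by positivity
          linarith
        · rw [not_le] at h
          rw [sub_nonpos, le_div_iff₀ htpos, sq]
          exact mul_le_mul_of_nonneg_left h.le (by positivity)
      have h2 := sum_le_sum h1
      rw [sum_sub_distrib, ← sum_div] at h2
      have h3 : (∑ x ∈ Eb n e, (dg L S e x : ℝ)) = Nc L S := by
        rw [← sum_dg L S e]; push_cast; rfl
      rw [h3] at h2
      have h4 : (∑ x ∈ Eb n e, ((dg L S e x : ℕ) : ℝ) ^ 2) / t ≤ g * μ / 4 := by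
        rw [div_le_iff₀ htpos]
        refine hsq.trans (le_of_eq ?_)
        rw [ht]; ring
      linarith
    rw [hW]
    refine stage (I := Is EH n) (c := cI b) (A := AI) (fun i => cI_nonneg i) hb (d := d) hd0 _ _ _ t
      (le_refl _) (fun x _ => hdt x) htpos.le ?_ hEW ?_
    · rw [hW, disjoint_union_right] at hdis; exact hdis.1
    · intro S' hS1 hS2 hS3 hS4
      apply ih
      · rw [card_sdiff_of_subset (insert_subset heE hL), card_insert_of_notMem heL]
        rw [card_sdiff_of_subset hL] at hk
        omega
      · exact insert_subset heE hL
      · rw [hW, disjoint_union_right] at hdis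
        refine disjoint_of_subset_left hS2 ?_
        rw [disjoint_union_left]
        exact ⟨hdis.2, hEW⟩
      · rw [hW] at hPsi
        exact hS4.trans hPsi
      · rw [card_insert_of_notMem heL]
        have h1 : ∑ x ∈ S' \ S, d x ≤ Nc (insert e L) S' := by
          refine (sum_le_sum (fun x _ => hdle x)).trans ?_
          have := sum_dg_le (L := L) (e := e) hS1
          exact_mod_cast this
        have h2 : 2 * (b : ℝ) * t = g * μ / 4 := by
          rw [ht]
          calc 2 * (b : ℝ) * (g / 8 * μ * p) = (b * p) * (g * μ / 4) := by ring
            _ = _ := by rw [hbp, one_mul]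
        have h3 : g * μ / 2 ≤ 2 * b * ∑ x ∈ S' \ S, d x := by linarith
        have h4 : g * μ / 4 * p ≤ ∑ x ∈ S' \ S, d x := by
          have h5 : p * (g * μ / 2) ≤ p * (2 * b * ∑ x ∈ S' \ S, d x) :=
            mul_le_mul_of_nonneg_left h3 hppos.le
          have h6 : p * (2 * b * ∑ x ∈ S' \ S, d x) = 2 * ∑ x ∈ S' \ S, d x := by
            calc _ = (b * p) * (2 * ∑ x ∈ S' \ S, d x) := by ring
              _ = _ := by rw [hbp, one_mul]
          linarith
        refine le_trans (le_of_eq ?_) (h4.trans h1)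
        rw [hμ, hg, pow_succ, pow_succ]; ring

theorem main_ens0 {EH : Finset (Sym2 α)} {b : ℕ} (hn : 1 ≤ n) (hb : 1 ≤ b)
    (hdens : ∀ J : Finset α, (∃ e ∈ EH, ∀ a ∈ e, a ∈ J) →
      (b : ℝ) ^ (loc EH J).card ≤ cc EH * (n : ℝ) ^ J.card) :
    Ens b (fun S => Psi EH n b S ∅ ≤ TT EH ∧
        (1 / 4 : ℝ) ^ EH.card * ((n : ℝ) ^ (Fintype.card α) * (1 / (b : ℝ)) ^ EH.card) ≤ Nc EH S)
        (Wb n EH) ∅ := by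
  have := main_ens hn hb hdens _ ∅ ∅ rfl (empty_subset _) (disjoint_empty_left _)
    (Psi_init hn hb _) (by simp [Nc])
  simpa using this

end graph

section final
open GraphDefs
variable {α : Type*} [Fintype α] [DecidableEq α]

theorem mem_EH {β : Type*} [Finite β] (H : SimpleGraph β) (e : Sym2 β) : e ∈ edgeBoard H ↔ e ∈ H.edgeSet := by
  simp [edgeBoard]

theorem board_eq (H : SimpleGraph α) (n : ℕ) : edgeBoard (Kpart H n) = Wb n (edgeBoard H) := by
  ext x
  induction x using Sym2.ind with
  | _ x y =>
    rw [mem_EH, Wb, mem_filter, mem_EH]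
    simp [Kpart]

theorem eIn_eq (H : SimpleGraph α) (J : Finset α) :
    eIn H (↑J : Set α) = (loc (edgeBoard H) J).card := by
  unfold eIn
  rw [← Set.ncard_coe_finset]
  congr 1
  ext e
  simp [mem_loc, mem_EH]

theorem eIn_univ (H : SimpleGraph α) : eIn H Set.univ = (edgeBoard H).card := by
  rw [← coe_univ, eIn_eq]
  congr 1
  ext e
  simp [mem_loc]

theorem dens_le (H : SimpleGraph α) (J : Finset α) (hJ : J.Nonempty) :
    ((loc (edgeBoard H) J).card : ℝ) ≤ maxDensity H * J.card := by
  have hpos : (0 : ℝ) < J.card := by exact_mod_cast hJ.card_pos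
  rw [← div_le_iff₀ hpos]
  unfold maxDensity
  apply le_csSup
  · apply Set.Finite.bddAbove
    apply Set.Finite.subset (Set.finite_range (fun H' : H.Subgraph =>
      (H'.edgeSet.ncard : ℝ) / (H'.verts.ncard : ℝ)))
    rintro d ⟨H', _, rfl⟩
    exact ⟨H', rfl⟩
  · refine ⟨(⊤ : H.Subgraph).induce (↑J : Set α), ?_, ?_⟩
    · simpa using hJ
    · have h1 : ((⊤ : H.Subgraph).induce (↑J : Set α)).edgeSet = ↑(loc (edgeBoard H) J) := by
        ext e
        induction e using Sym2.ind with
        | _ x y =>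
          simp [mem_loc, mem_EH]
          tauto
      rw [h1, Set.ncard_coe_finset]
      simp

theorem dens (H : SimpleGraph α) {n b : ℕ} {c : ℝ} (hc : 0 < c) (hc1 : c ≤ 1) (hb : 1 ≤ b)
    (hlt : (b : ℝ) < c * (n : ℝ) ^ (1 / maxDensity H)) (J : Finset α)
    (hJ : ∃ e ∈ edgeBoard H, ∀ a ∈ e, a ∈ J) :
    (b : ℝ) ^ (loc (edgeBoard H) J).card ≤ c * (n : ℝ) ^ J.card := by
  obtain ⟨e, he, heJ⟩ := hJ
  have hne : J.Nonempty := by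
    induction e using Sym2.ind with
    | _ x y => exact ⟨x, heJ x (by simp)⟩
  set k := (loc (edgeBoard H) J).card with hk
  have hk1 : 1 ≤ k := card_pos.mpr ⟨e, mem_loc.mpr ⟨he, heJ⟩⟩
  have hd := dens_le H J hne
  rw [← hk] at hd
  have hJpos : (0 : ℝ) < J.card := by exact_mod_cast hne.card_pos
  have hm : 0 < maxDensity H := by
    have : (1 : ℝ) ≤ k := by exact_mod_cast hk1
    by_contra hcon
    have := mul_nonpos_of_nonpos_of_nonneg (not_lt.mp hcon) hJpos.le
    linarith
  have hb1 : (1 : ℝ) ≤ b := by exact_mod_cast hb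
  set q : ℝ := b / c with hq
  have hq1 : 1 ≤ q := by rw [hq, one_le_div hc]; linarith
  have hqn : q ≤ (n : ℝ) ^ (1 / maxDensity H) := by
    rw [hq, div_le_iff₀ hc]; linarith
  have h1 : q ^ k ≤ (n : ℝ) ^ J.card := by
    calc q ^ k = q ^ (k : ℝ) := (Real.rpow_natCast _ _).symm
      _ ≤ q ^ (maxDensity H * J.card) := Real.rpow_le_rpow_of_exponent_le hq1 hd
      _ ≤ ((n : ℝ) ^ (1 / maxDensity H)) ^ (maxDensity H * J.card) :=
          Real.rpow_le_rpow (by linarith) hqn (by positivity)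
      _ = (n : ℝ) ^ (J.card : ℝ) := by
          rw [← Real.rpow_mul (by positivity)]
          congr 1
          field_simp
      _ = _ := Real.rpow_natCast _ _
  have h2 : (b : ℝ) = c * q := by rw [hq]; field_simp
  rw [h2, mul_pow]
  have h3 : c ^ k ≤ c := by
    calc c ^ k ≤ c ^ 1 := pow_le_pow_of_le_one hc.le hc1 hk1
      _ = c := pow_one c
  exact mul_le_mul h3 h1 (by positivity) hc.le

theorem copy_iff (H : SimpleGraph α) {n : ℕ} (S : Finset (Sym2 (α × Fin n))) (J : Finset α)
    (f : α → Fin n) :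
    (loc (edgeBoard H) J).image (cp f) ⊆ S ↔ ∀ a ∈ J, ∀ b ∈ J, H.Adj a b →
      (SimpleGraph.fromEdgeSet (↑S : Set (Sym2 (α × Fin n)))).Adj (a, f a) (b, f b) := by
  constructor
  · intro h a ha b hb hab
    rw [SimpleGraph.fromEdgeSet_adj]
    refine ⟨?_, fun h => hab.ne (congrArg Prod.fst h)⟩
    apply mem_coe.mpr
    apply h
    refine mem_image.mpr ⟨s(a, b), mem_loc.mpr ⟨(mem_EH H _).mpr hab, ?_⟩, rfl⟩
    intro x hx
    rcases Sym2.mem_iff.mp hx with rfl | rfl <;> assumption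
  · intro h x hx
    obtain ⟨e, he, rfl⟩ := mem_image.mp hx
    obtain ⟨he1, he2⟩ := mem_loc.mp he
    rw [mem_EH] at he1
    induction e using Sym2.ind with
    | _ a b =>
      have := h a (he2 a (by simp)) b (he2 b (by simp)) he1
      rw [SimpleGraph.fromEdgeSet_adj] at this
      exact mem_coe.mp this.1

theorem loc_univ (L : Finset (Sym2 α)) : loc L univ = L := by
  ext e; simp [mem_loc]

theorem loc_loc_univ (L : Finset (Sym2 α)) (J : Finset α) : loc (loc L J) univ = loc L J :=
  loc_univ _

theorem P1_le (H : SimpleGraph α) {n : ℕ} (S : Finset (Sym2 (α × Fin n))) :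
    Nc (edgeBoard H) S ≤
      NCopies H n (SimpleGraph.fromEdgeSet (↑S : Set (Sym2 (α × Fin n)))) Set.univ := by
  unfold Nc NCopies
  rw [← Set.ncard_coe_finset]
  apply Set.ncard_le_ncard_of_injOn (fun f => fun a : (Set.univ : Set α) => f a.1)
  · intro f hf
    have h := (mem_filter.mp (mem_coe.mp hf)).2
    rw [← loc_univ (edgeBoard H), copy_iff] at h
    intro a b hab
    exact h a (mem_univ _) b (mem_univ _) hab
  · intro f _ g _ h
    funext a
    exact congrFun h ⟨a, trivial⟩

theorem P2_le (H : SimpleGraph α) {n : ℕ} (S : Finset (Sym2 (α × Fin n))) (J : Finset α) :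
    NCopies H n (SimpleGraph.fromEdgeSet (↑S : Set (Sym2 (α × Fin n)))) (↑J : Set α) *
      n ^ (Fintype.card α - J.card) ≤ Qc (loc (edgeBoard H) J) univ S := by
  classical
  unfold Qc NCopies
  set M := canonCopies H n (SimpleGraph.fromEdgeSet (↑S : Set (Sym2 (α × Fin n)))) (↑J : Set α)
  have hM : M.ncard = (M.toFinite.toFinset).card := Set.ncard_eq_toFinset_card _ _
  have h2 : n ^ (Fintype.card α - J.card) = (univ : Finset ({a // a ∉ J} → Fin n)).card := by
    rw [card_univ, Fintype.card_fun, Fintype.card_fin, Fintype.card_subtype_compl,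
      Fintype.card_coe]
  rw [hM, h2, ← card_product]
  let ext2 : ((↑J : Set α) → Fin n) × ({a // a ∉ J} → Fin n) → (α → Fin n) := fun gh a =>
    if h : a ∈ J then gh.1 ⟨a, h⟩ else gh.2 ⟨a, h⟩
  apply card_le_card_of_injOn (fun gh => (ext2 gh, ext2 gh))
  · rintro ⟨g, h⟩ hgh
    have hg := (mem_product.mp (mem_coe.mp hgh)).1
    rw [Set.Finite.mem_toFinset] at hg
    have hg' : ∀ a b : (↑J : Set α), H.Adj a b → (SimpleGraph.fromEdgeSet
      (↑S : Set (Sym2 (α × Fin n)))).Adj ((a : α), g a) ((b : α), g b) := hg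
    refine mem_coe.mpr (mem_filter.mpr ⟨mem_univ _, by simp [agr], ?_⟩)
    unfold img
    rw [union_self, copy_iff]
    intro a ha b hb hab
    have := hg' ⟨a, ha⟩ ⟨b, hb⟩ hab
    simpa [ext2, ha, hb] using this
  · rintro ⟨g, h⟩ _ ⟨g', h'⟩ _ heq
    have heq' : ext2 (g, h) = ext2 (g', h') := congrArg Prod.fst heq
    refine Prod.ext ?_ ?_
    · funext ⟨a, ha⟩
      have ha' : a ∈ J := ha
      have := congrFun heq' a
      simpa [ext2, ha'] using this
    · funext ⟨a, ha⟩
      have := congrFun heq' a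
      simpa [ext2, ha] using this

theorem P3_le (H : SimpleGraph α) {n : ℕ} (S : Finset (Sym2 (α × Fin n))) (J : Finset α) :
    NOverlap H n (SimpleGraph.fromEdgeSet (↑S : Set (Sym2 (α × Fin n)))) (↑J : Set α)
      ≤ Qc (edgeBoard H) J S := by
  unfold Qc NOverlap
  rw [← Set.ncard_coe_finset]
  apply Set.ncard_le_ncard _ (Set.toFinite _)
  rintro ⟨f, f'⟩ ⟨h1, h2, h3, h4⟩
  refine mem_coe.mpr (mem_filter.mpr ⟨mem_univ _, ?_, ?_⟩)
  · ext a
    simp only [agr, mem_filter, mem_univ, true_and]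
    constructor
    · intro h; by_contra hc; exact h4 a (by simpa using hc) h
    · intro h; exact h3 a (by simpa using h)
  · unfold img
    rw [← loc_univ (edgeBoard H)]
    apply union_subset
    · rw [copy_iff]; intro a _ b _ hab; exact h1 a b hab
    · rw [copy_iff]; intro a _ b _ hab; exact h2 a b hab

theorem cc_pos (EH : Finset (Sym2 α)) : 0 < cc EH := by
  have := TT_pos EH
  unfold cc
  positivity

theorem cc_le (EH : Finset (Sym2 α)) : cc EH ≤ 1 := by
  have := TT_pos EH
  unfold cc
  rw [div_le_one (by positivity)]
  have h1 : ((1 / 4 : ℝ) ^ EH.card) ^ 2 ≤ 1 :=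
    pow_le_one₀ (by positivity) (pow_le_one₀ (by norm_num) (by norm_num))
  have h2 : (1 : ℝ) ≤ 2 ^ Fintype.card α := one_le_pow₀ (by norm_num)
  nlinarith

end final

end WCProof


open Filter GraphDefs WCGame in
/-- Theorem 2 of the paper: For every graph `H` with at least one
edge there exist `c, T, γ > 0` such that for all sufficiently large `n` and
every integer `b` with `1 ≤ b < c·n^(1/m(H))`, in the `b`-Waiter-Client game on
the edges of `K_n^H`, Waiter can ensure that, with `p = 1/b`, Client's final
graph `G ⊆ K_n^H` satisfies (P1), (P2) and (P3). -/
theorem waiter_client_main_inductive {α : Type*} [Fintype α] [DecidableEq α]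
    (H : SimpleGraph α) (hH : H.edgeSet.Nonempty) :
    ∃ c T γ : ℝ, 0 < c ∧ 0 < T ∧ 0 < γ ∧
      ∀ᶠ n : ℕ in atTop, ∀ b : ℕ, 1 ≤ b →
        (b : ℝ) < c * (n : ℝ) ^ (1 / maxDensity H) →
        WaiterCanEnsure (edgeBoard (Kpart H n)) b
          (fun S =>
            let G := SimpleGraph.fromEdgeSet (↑S : Set (Sym2 (α × Fin n)))
            let p : ℝ := 1 / b
            -- (P1)
            (γ * (n : ℝ) ^ (Fintype.card α) * p ^ (eIn H Set.univ) ≤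
                (NCopies H n G Set.univ : ℝ)) ∧
            -- (P2): for every induced subgraph H' = H[s] of H
            (∀ s : Set α, (NCopies H n G s : ℝ) ≤
                T * (n : ℝ) ^ (s.ncard) * p ^ (eIn H s)) ∧
            -- (P3): for every induced subgraph J = H[s] of H
            (∀ s : Set α, (NOverlap H n G s : ℝ) ≤
                T * (n : ℝ) ^ (2 * Fintype.card α - s.ncard) *
                  p ^ (2 * eIn H Set.univ - eIn H s))) := by
  classical
  have hTp := WCProof.TT_pos (edgeBoard H)
  refine ⟨WCProof.cc (edgeBoard H), WCProof.TT (edgeBoard H), (1 / 4 : ℝ) ^ (edgeBoard H).card,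
    WCProof.cc_pos _, by linarith, by positivity, ?_⟩
  filter_upwards [eventually_ge_atTop 1] with n hn b hb hlt
  have hnpos : (0 : ℝ) < n := by exact_mod_cast hn
  have hens := WCProof.main_ens0 (n := n) hn hb
    (WCProof.dens H (WCProof.cc_pos _) (WCProof.cc_le _) hb hlt)
  rw [← WCProof.board_eq] at hens
  obtain ⟨W, hW, hC⟩ := WCProof.canEnsure hb hens
  refine ⟨W, hW, fun C hCl => ?_⟩
  obtain ⟨h1, h2⟩ := hC C hCl
  generalize finalSet (edgeBoard (Kpart H n)) W C = S at h1 h2 ⊢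
  intro G p
  refine ⟨?_, ?_, ?_⟩
  · rw [WCProof.eIn_univ, mul_assoc]
    refine h2.trans ?_
    exact_mod_cast WCProof.P1_le H S
  · intro s
    obtain ⟨J, rfl⟩ : ∃ J : Finset α, (↑J : Set α) = s := ⟨s.toFinite.toFinset, by simp⟩
    rw [WCProof.eIn_eq, Set.ncard_coe_finset]
    have hJ : J.card ≤ Fintype.card α := Finset.card_le_univ J
    have h3 := WCProof.Qc_le hn hb (L := WCProof.loc (edgeBoard H) J)
      (fun x hx => (WCProof.mem_loc.mp hx).1) Finset.univ S ∅ h1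
    have h4 : (NCopies H n G (↑J : Set α) : ℝ) * (n : ℝ) ^ (Fintype.card α - J.card) ≤
        (WCProof.Qc (WCProof.loc (edgeBoard H) J) Finset.univ S : ℝ) := by
      exact_mod_cast WCProof.P2_le H S J
    have h5 : WCProof.tgt n b (WCProof.loc (edgeBoard H) J) Finset.univ =
        ((n : ℝ) ^ J.card * p ^ (WCProof.loc (edgeBoard H) J).card) *
          (n : ℝ) ^ (Fintype.card α - J.card) := by
      unfold WCProof.tgt
      rw [WCProof.loc_univ, Finset.card_univ, two_mul, Nat.add_sub_cancel, two_mul,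
        Nat.add_sub_cancel]
      have : (n : ℝ) ^ Fintype.card α = (n : ℝ) ^ J.card * (n : ℝ) ^ (Fintype.card α - J.card) := by
        rw [← pow_add]; congr 1; omega
      rw [this]
      ring
    have h6 := h4.trans h3
    rw [h5, ← mul_assoc, ← mul_assoc] at h6
    exact le_of_mul_le_mul_right h6 (by positivity)
  · intro s
    obtain ⟨J, rfl⟩ : ∃ J : Finset α, (↑J : Set α) = s := ⟨s.toFinite.toFinset, by simp⟩
    rw [WCProof.eIn_eq, WCProof.eIn_univ, Set.ncard_coe_finset]
    have h3 := WCProof.Qc_le hn hb (le_refl (edgeBoard H)) J S ∅ h1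
    have h4 : (NOverlap H n G (↑J : Set α) : ℝ) ≤ (WCProof.Qc (edgeBoard H) J S : ℝ) := by
      exact_mod_cast WCProof.P3_le H S J
    rw [mul_assoc]
    exact h4.trans h3
end

section
/- Let V_x and V_y be disjoint sets of size n, let b ≥ 1 be an integer with b ≤ n²/2, let G be a bipartite graph with parts V_x and V_y having at most n²/(8b) edges, and let O ⊆ V_x × V_y be a set of pairs with |O| ≤ n²/8. Then there exist at least b pairs (u, w) ∈ (V_x × V_y) \ O such that u has degree at most n/b in G and w has degree at most n/b in G. -/
theorem low_deg_aux (n b : ℕ) (hb : 1 ≤ b) (hn : 0 < n) (G : Finset (Fin n × Fin n))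
    (f : Fin n × Fin n → Fin n)
    (hG : (G.card : ℝ) ≤ (n : ℝ) ^ 2 / (8 * b)) :
    ((Finset.univ.filter (fun u : Fin n =>
      (n : ℝ) / b < ((G.filter (fun e => f e = u)).card : ℝ))).card : ℝ) ≤ (n : ℝ) / 8 := by
  set B := Finset.univ.filter (fun u : Fin n =>
      (n : ℝ) / b < ((G.filter (fun e => f e = u)).card : ℝ)) with hB
  have hb' : (0 : ℝ) < b := by exact_mod_cast hb
  have hn' : (0 : ℝ) < n := by exact_mod_cast hn
  have h1 : G.card = ∑ u : Fin n, (G.filter (fun e => f e = u)).card :=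
    Finset.card_eq_sum_card_fiberwise (fun _ _ => by simp)
  have h2 : ∑ u ∈ B, (G.filter (fun e => f e = u)).card ≤ G.card := by
    rw [h1]
    exact Finset.sum_le_sum_of_subset (Finset.subset_univ _)
  have h3 : (B.card : ℝ) * ((n : ℝ) / b) ≤ ∑ u ∈ B, ((G.filter (fun e => f e = u)).card : ℝ) := by
    rw [← nsmul_eq_mul]
    refine Finset.card_nsmul_le_sum _ _ _ (fun u hu => ?_)
    exact (Finset.mem_filter.1 hu).2.le
  have h4 : (∑ u ∈ B, ((G.filter (fun e => f e = u)).card : ℝ)) ≤ G.card := by exact_mod_cast h2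
  have h5 : (B.card : ℝ) * ((n : ℝ) / b) ≤ (n : ℝ) / 8 * ((n : ℝ) / b) := by
    refine (h3.trans (h4.trans hG)).trans (le_of_eq ?_)
    field_simp
  exact le_of_mul_le_mul_right h5 (by positivity)

/-- if a bipartite graph `G` on parts of size `n` (edges encoded as
pairs) has at most `n²/(8b)` edges and `O` is a set of at most `n²/8` pairs,
then (provided `1 ≤ b ≤ n²/2`) there are at least `b` pairs `(u,w) ∉ O` such
that both `u` and `w` have degree at most `n/b` in `G`. -/
theorem many_low_degree_pairs (n b : ℕ) (hb : 1 ≤ b) (hbn : (b : ℝ) ≤ (n : ℝ) ^ 2 / 2)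
    (G O : Finset (Fin n × Fin n))
    (hG : (G.card : ℝ) ≤ (n : ℝ) ^ 2 / (8 * b))
    (hO : (O.card : ℝ) ≤ (n : ℝ) ^ 2 / 8) :
    (b : ℝ) ≤ (Set.ncard { v : Fin n × Fin n | v ∉ O ∧
      ((G.filter (fun e => e.1 = v.1)).card : ℝ) ≤ (n : ℝ) / b ∧
      ((G.filter (fun e => e.2 = v.2)).card : ℝ) ≤ (n : ℝ) / b } : ℝ) := by
  have hb' : (1 : ℝ) ≤ b := by exact_mod_cast hb
  have hn : 0 < n := by
    rcases Nat.eq_zero_or_pos n with h | h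
    · subst h
      norm_num at hbn
      omega
    · exact h
  have h1 := low_deg_aux n b hb hn G Prod.fst hG
  have h2 := low_deg_aux n b hb hn G Prod.snd hG
  set B1 := Finset.univ.filter (fun u : Fin n =>
      (n : ℝ) / b < ((G.filter (fun e => Prod.fst e = u)).card : ℝ)) with hB1
  set B2 := Finset.univ.filter (fun u : Fin n =>
      (n : ℝ) / b < ((G.filter (fun e => Prod.snd e = u)).card : ℝ)) with hB2
  set S := { v : Fin n × Fin n | v ∉ O ∧
      ((G.filter (fun e => e.1 = v.1)).card : ℝ) ≤ (n : ℝ) / b ∧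
      ((G.filter (fun e => e.2 = v.2)).card : ℝ) ≤ (n : ℝ) / b } with hS
  have hfin : S.Finite := Set.toFinite S
  rw [Set.ncard_eq_toFinset_card S hfin]
  have hsub : (Finset.univ : Finset (Fin n × Fin n)) ⊆
      (hfin.toFinset ∪ O) ∪ (B1 ×ˢ Finset.univ ∪ Finset.univ ×ˢ B2) := by
    intro v _
    simp only [Finset.mem_union, Set.Finite.mem_toFinset, Finset.mem_product, Finset.mem_univ,
      and_true, true_and]
    by_cases ho : v ∈ O
    · exact Or.inl (Or.inr ho)
    by_cases ha : v.1 ∈ B1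
    · exact Or.inr (Or.inl ha)
    by_cases hc : v.2 ∈ B2
    · exact Or.inr (Or.inr hc)
    refine Or.inl (Or.inl ⟨ho, ?_, ?_⟩)
    · rw [hB1, Finset.mem_filter] at ha
      exact not_lt.1 fun h => ha ⟨Finset.mem_univ _, h⟩
    · rw [hB2, Finset.mem_filter] at hc
      exact not_lt.1 fun h => hc ⟨Finset.mem_univ _, h⟩
  have hc : n * n ≤ (hfin.toFinset.card + O.card) + (B1.card * n + n * B2.card) := by
    have := (Finset.card_le_card hsub).trans (Finset.card_union_le _ _)
    have e1 := Finset.card_union_le hfin.toFinset O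
    have e2 := Finset.card_union_le (B1 ×ˢ (Finset.univ : Finset (Fin n)))
      ((Finset.univ : Finset (Fin n)) ×ˢ B2)
    simp only [Finset.card_product, Finset.card_univ, Fintype.card_fin, Fintype.card_prod]
      at this e2
    omega
  have hc' : (n : ℝ) * n ≤ (hfin.toFinset.card + O.card) + (B1.card * n + n * B2.card) := by
    exact_mod_cast hc
  have hn' : (0 : ℝ) < n := by exact_mod_cast hn
  nlinarith [mul_le_mul_of_nonneg_right h1 hn'.le, mul_le_mul_of_nonneg_left h2 hn'.le]
end

section
/- Let H be a graph with vertex set {h_1,…,h_k}, let x = h_i and y = h_j be two distinct vertices of H, and let G ⊆ K_n^H. Then ∑_{v ∈ V_i × V_j} deg_G(v, H)² ≤ 2·∑_J N_G(H^J), where the sum is over all induced subgraphs J ⊆ H with {x, y} ⊆ V(J). -/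
open GraphDefs in
/-- `∑_{v ∈ V_x × V_y} deg_G(v, H)² ≤ 2·∑_J N_G(H^J)`, the sum on
the right ranging over all induced subgraphs `J = H[s]` of `H` with `x, y ∈ s`. -/
theorem sum_degree_squared_le {α : Type*} [Fintype α] [DecidableEq α]
    (H : SimpleGraph α) (n : ℕ) (x y : α) (hxy : x ≠ y)
    (G : SimpleGraph (α × Fin n)) (hG : G ≤ Kpart H n) :
    ∑ u : Fin n, ∑ w : Fin n, (degPair H n G Set.univ x u y w) ^ 2 ≤
      2 * ∑ t ∈ Finset.univ.powerset.filter (fun t : Finset α => x ∈ t ∧ y ∈ t),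
        NOverlap H n G ↑t := by
  classical
  let C : Finset (α → Fin n) :=
    Finset.univ.filter (fun f => ∀ a b : α, H.Adj a b → G.Adj (a, f a) (b, f b))
  let P : Finset ((α → Fin n) × (α → Fin n)) :=
    (C ×ˢ C).filter (fun p => p.1 x = p.2 x ∧ p.1 y = p.2 y)
  have hdeg : ∀ u w, degPair H n G Set.univ x u y w =
      (C.filter (fun f => f x = u ∧ f y = w)).card := by
    intro u w
    rw [degPair, ← Set.ncard_coe_finset]
    refine Set.ncard_congr (fun f _ => fun a => f ⟨a, Set.mem_univ a⟩) ?_ ?_ ?_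
    · rintro f ⟨hf, ⟨⟨a, ha⟩, rfl, h1⟩, ⟨⟨b, hb⟩, rfl, h2⟩⟩
      simp only [C, Finset.coe_filter, Finset.mem_filter, Finset.mem_univ, true_and,
        Set.mem_setOf_eq]
      exact ⟨fun a b hab => hf ⟨a, Set.mem_univ a⟩ ⟨b, Set.mem_univ b⟩ hab, h1, h2⟩
    · intro f g _ _ h
      funext ⟨a, ha⟩
      exact congrFun h a
    · intro g hg
      simp only [C, Finset.coe_filter, Finset.mem_filter, Finset.mem_univ, true_and,
        Set.mem_setOf_eq] at hg
      exact ⟨fun a => g a, ⟨fun a b hab => hg.1 a b hab,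
        ⟨⟨x, Set.mem_univ x⟩, rfl, hg.2.1⟩, ⟨⟨y, Set.mem_univ y⟩, rfl, hg.2.2⟩⟩, rfl⟩
  have hL : ∑ u : Fin n, ∑ w : Fin n, (degPair H n G Set.univ x u y w) ^ 2 = P.card := by
    rw [← Fintype.sum_prod_type' (f := fun u w => (degPair H n G Set.univ x u y w) ^ 2),
      Finset.card_eq_sum_card_fiberwise (s := P) (t := Finset.univ)
        (f := fun p => (p.1 x, p.1 y)) (fun _ _ => Finset.mem_coe.2 (Finset.mem_univ _))]
    refine Finset.sum_congr rfl fun q _ => ?_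
    rw [hdeg, sq, ← Finset.card_product]
    congr 1
    ext ⟨f, g⟩
    obtain ⟨u, w⟩ := q
    simp only [P, Finset.mem_product, Finset.mem_filter, Prod.mk.injEq]
    constructor
    · rintro ⟨⟨hf, rfl, rfl⟩, hg, h1, h2⟩
      exact ⟨⟨⟨hf, hg⟩, h1.symm, h2.symm⟩, rfl, rfl⟩
    · rintro ⟨⟨⟨hf, hg⟩, h1, h2⟩, rfl, rfl⟩
      exact ⟨⟨hf, rfl, rfl⟩, hg, h1.symm, h2.symm⟩
  have hR : ∑ t ∈ Finset.univ.powerset.filter (fun t : Finset α => x ∈ t ∧ y ∈ t),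
        NOverlap H n G ↑t = P.card := by
    rw [Finset.card_eq_sum_card_fiberwise (s := P)
        (t := Finset.univ.powerset.filter (fun t : Finset α => x ∈ t ∧ y ∈ t))
        (f := fun p => Finset.univ.filter (fun a => p.1 a = p.2 a))]
    · refine Finset.sum_congr rfl fun t ht => ?_
      rw [NOverlap, ← Set.ncard_coe_finset]
      congr 1
      ext ⟨f, g⟩
      simp only [Finset.mem_filter] at ht
      simp only [P, C, overlapCopies, Finset.coe_filter, Finset.mem_filter, Finset.mem_product,
        Finset.mem_univ, true_and, Set.mem_setOf_eq, Finset.mem_coe, Finset.ext_iff]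
      constructor
      · rintro ⟨hf, hg, h1, h2⟩
        exact ⟨⟨⟨hf, hg⟩, h1 x ht.2.1, h1 y ht.2.2⟩,
          fun a => ⟨fun h => by_contra fun hn => h2 a hn h, h1 a⟩⟩
      · rintro ⟨⟨⟨hf, hg⟩, -, -⟩, h⟩
        exact ⟨hf, hg, fun a ha => (h a).2 ha, fun a ha e => ha ((h a).1 e)⟩
    · intro p hp
      have hp' := (Finset.mem_filter.1 (Finset.mem_coe.1 hp)).2
      simpa using hp'
  rw [hL, hR]
  omega
end

section
/- Let H_e be a graph with vertex set {h_1,…,h_k}, let x and y be two distinct non-adjacent vertices of H_e, let γ, T > 0, p ∈ (0,1], n ∈ ℕ, and let G ⊆ K_n^{H_e} satisfy: N_G(H_e) ≥ γ·n^{v(H_e)}·p^{e(H_e)}; N_G(H') ≤ T·n^{v(H')}·p^{e(H')} for every induced subgraph H' ⊆ H_e; and N_G(H_e^J) ≤ T·n^{2v(H_e)−v(J)}·p^{2e(H_e)−e(J)} for every induced subgraph J ⊆ H_e. Let F be an induced subgraph of H_e containing both x and y that minimises n^{v(F)}·p^{e(F)} among all such induced subgraphs. Let P ⊆ V_x ×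 V_y be the set of pairs v with deg_G(v, H_e) ≥ 1, assume P is nonempty, and let L = { v ∈ P : deg_G(v, H_e) ≥ N_G(H_e)/(2|P|) }. Then |L| ≥ (γ²/(2^{v(H_e)+2}·T))·n^{v(F)}·p^{e(F)}. -/
namespace SizeOfLAux
open GraphDefs Classical

noncomputable def CC {α : Type*} [Fintype α] [DecidableEq α]
    (H : SimpleGraph α) (n : ℕ) (G : SimpleGraph (α × Fin n)) : Finset (α → Fin n) :=
  Finset.univ.filter (fun f => ∀ a b : α, H.Adj a b → G.Adj (a, f a) (b, f b))

theorem degPair_eq {α : Type*} [Fintype α] [DecidableEq α]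
    (H : SimpleGraph α) (n : ℕ) (G : SimpleGraph (α × Fin n)) (x y : α) (u w : Fin n) :
    degPair H n G Set.univ x u y w =
      ((CC H n G).filter (fun f => (f x, f y) = (u, w))).card := by
  rw [← Set.ncard_coe_finset]
  unfold degPair
  refine Set.ncard_congr (fun f _ a => f ⟨a, trivial⟩) ?_ ?_ ?_
  · rintro f ⟨hf, ⟨a, ha, hau⟩, ⟨b, hb, hbw⟩⟩
    subst ha hb
    simp only [CC, Finset.coe_filter, Finset.mem_filter, Finset.mem_univ, true_and,
      Set.mem_ofPred_eq]
    exact ⟨fun a b hab => hf ⟨a, trivial⟩ ⟨b, trivial⟩ hab, by rw [← hau, ← hbw]⟩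
  · intro f g _ _ h
    funext a
    exact congrFun h a.1
  · intro f hf
    simp only [CC, Finset.coe_filter, Finset.mem_filter, Finset.mem_univ, true_and,
      Set.mem_ofPred_eq, Prod.mk.injEq] at hf
    exact ⟨fun a => f a.1, ⟨fun a b hab => hf.1 a b hab, ⟨⟨x, trivial⟩, rfl, hf.2.1⟩,
      ⟨⟨y, trivial⟩, rfl, hf.2.2⟩⟩, rfl⟩

theorem NCopies_eq {α : Type*} [Fintype α] [DecidableEq α]
    (H : SimpleGraph α) (n : ℕ) (G : SimpleGraph (α × Fin n)) :
    NCopies H n G Set.univ = (CC H n G).card := by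
  rw [← Set.ncard_coe_finset]
  unfold NCopies
  refine Set.ncard_congr (fun f _ a => f ⟨a, trivial⟩) ?_ ?_ ?_
  · intro f hf
    simp only [CC, Finset.coe_filter, Finset.mem_univ, true_and, Set.mem_ofPred_eq]
    exact fun a b hab => hf ⟨a, trivial⟩ ⟨b, trivial⟩ hab
  · intro f g _ _ h
    funext a
    exact congrFun h a.1
  · intro f hf
    simp only [CC, Finset.coe_filter, Finset.mem_univ, true_and,
      Set.mem_ofPred_eq] at hf
    exact ⟨fun a => f a.1, fun a b hab => hf a b hab, rfl⟩

/-- sum of squared degrees is at most the sum of overlap counts -/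
theorem sum_sq_le {α : Type*} [Fintype α] [DecidableEq α]
    (H : SimpleGraph α) (n : ℕ) (G : SimpleGraph (α × Fin n)) (x y : α) :
    ∑ v : Fin n × Fin n, (degPair H n G Set.univ x v.1 y v.2) ^ 2 ≤
      ∑ t ∈ (Finset.univ : Finset (Finset α)).filter (fun t => x ∈ t ∧ y ∈ t),
        NOverlap H n G (t : Set α) := by
  set Q : Finset ((α → Fin n) × (α → Fin n)) :=
    (CC H n G ×ˢ CC H n G).filter (fun q => (q.1 x, q.1 y) = (q.2 x, q.2 y)) with hQ
  have e1 : ∑ v : Fin n × Fin n, (degPair H n G Set.univ x v.1 y v.2) ^ 2 = Q.card := by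
    rw [Finset.card_eq_sum_card_fiberwise (f := fun q => (q.1 x, q.1 y)) (t := Finset.univ)
      (fun _ _ => Finset.mem_coe.2 (Finset.mem_univ _))]
    refine Finset.sum_congr rfl fun v _ => ?_
    rw [degPair_eq, sq, ← Finset.card_product]
    congr 1
    ext q
    simp only [hQ, Finset.mem_filter, Finset.mem_product]
    constructor
    · rintro ⟨⟨a, b⟩, c, d⟩
      exact ⟨⟨⟨a, c⟩, b.trans d.symm⟩, b⟩
    · rintro ⟨⟨⟨a, c⟩, e⟩, b⟩
      exact ⟨⟨a, b⟩, c, e.symm.trans b⟩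
  rw [e1, Finset.card_eq_sum_card_fiberwise
    (f := fun q : (α → Fin n) × (α → Fin n) => Finset.univ.filter (fun a => q.1 a = q.2 a))
    (t := (Finset.univ : Finset (Finset α)).filter (fun t => x ∈ t ∧ y ∈ t))]
  · refine Finset.sum_le_sum fun t _ => ?_
    rw [← Set.ncard_coe_finset]
    unfold NOverlap
    refine Set.ncard_le_ncard ?_ (Set.toFinite _)
    intro q hq
    simp only [hQ, CC, Finset.coe_filter, Finset.mem_filter, Finset.mem_product,
      Finset.mem_univ, true_and, Set.mem_ofPred_eq] at hq
    obtain ⟨⟨⟨ha, hb⟩, -⟩, rfl⟩ := hq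
    refine ⟨ha, hb, ?_, ?_⟩
    · intro a h
      simpa using h
    · intro a h
      simpa using h
  · intro q hq
    simp only [hQ, Finset.coe_filter, Finset.mem_filter, Finset.mem_univ, true_and,
      Set.mem_ofPred_eq, Prod.mk.injEq] at hq ⊢
    exact hq.2

theorem eIn_le {α : Type*} [Fintype α] [DecidableEq α] (H : SimpleGraph α) (t : Set α) :
    eIn H t ≤ eIn H Set.univ := by
  unfold eIn
  exact Set.ncard_le_ncard (fun e he => ⟨he.1, fun _ _ => trivial⟩) (Set.toFinite _)

end SizeOfLAux

open GraphDefs in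
/-- lower bound `|L| ≥ (γ²/(2^(v(H_e)+2)·T))·n^(v(F))·p^(e(F))` on the
set `L` of pairs in `P` of at least average degree, where `F` is an induced
subgraph of `H_e` containing `x, y` minimising `n^(v(F))·p^(e(F))`. -/
theorem size_of_L {α : Type*} [Fintype α] [DecidableEq α]
    (He : SimpleGraph α) (n : ℕ) (x y : α) (hxy : x ≠ y) (hnadj : ¬ He.Adj x y)
    (γ T p : ℝ) (hγ : 0 < γ) (hT : 0 < T) (hp0 : 0 < p) (hp1 : p ≤ 1)
    (G : SimpleGraph (α × Fin n)) (hG : G ≤ Kpart He n)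
    (h1 : γ * (n : ℝ) ^ (Fintype.card α) * p ^ (eIn He Set.univ) ≤
      (NCopies He n G Set.univ : ℝ))
    (h2 : ∀ t : Set α, (NCopies He n G t : ℝ) ≤ T * (n : ℝ) ^ (t.ncard) * p ^ (eIn He t))
    (h3 : ∀ t : Set α, (NOverlap He n G t : ℝ) ≤
      T * (n : ℝ) ^ (2 * Fintype.card α - t.ncard) * p ^ (2 * eIn He Set.univ - eIn He t))
    (F : Set α) (hxF : x ∈ F) (hyF : y ∈ F)
    (hFmin : ∀ t : Set α, x ∈ t → y ∈ t →
      (n : ℝ) ^ (F.ncard) * p ^ (eIn He F) ≤ (n : ℝ) ^ (t.ncard) * p ^ (eIn He t))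
    (P L : Set (Fin n × Fin n))
    (hP : P = { v | 1 ≤ degPair He n G Set.univ x v.1 y v.2 })
    (hPne : P.Nonempty)
    (hL : L = { v ∈ P | (NCopies He n G Set.univ : ℝ) / (2 * P.ncard) ≤
                  (degPair He n G Set.univ x v.1 y v.2 : ℝ) }) :
    γ ^ 2 / (2 ^ (Fintype.card α + 2) * T) * (n : ℝ) ^ (F.ncard) * p ^ (eIn He F) ≤
      (L.ncard : ℝ) := by
  classical
  have hn : 0 < n := by
    obtain ⟨v, -⟩ := hPne
    exact v.1.pos
  have hnR : (0 : ℝ) < n := by exact_mod_cast hn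
  set k := Fintype.card α with hk
  set e := eIn He Set.univ with he
  set d : Fin n × Fin n → ℝ := fun v => (degPair He n G Set.univ x v.1 y v.2 : ℝ) with hd
  set N : ℝ := (NCopies He n G Set.univ : ℝ) with hN
  set μ : ℝ := (n : ℝ) ^ (F.ncard) * p ^ (eIn He F) with hμ
  have hμ0 : 0 < μ := by positivity
  set M : ℝ := (n : ℝ) ^ k * p ^ e with hM
  have hM0 : 0 < M := by positivity
  have hNM : γ * M ≤ N := by rw [hM, ← mul_assoc]; exact h1
  -- sum of degrees
  have hsum : ∑ v, d v = N := by
    rw [hN, SizeOfLAux.NCopies_eq, Finset.card_eq_sum_card_fiberwise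
      (f := fun f => (f x, f y)) (t := Finset.univ)
      (fun _ _ => Finset.mem_coe.2 (Finset.mem_univ _))]
    push_cast
    refine Finset.sum_congr rfl fun v _ => ?_
    simp only [hd, SizeOfLAux.degPair_eq]
  have hd0 : ∀ v, 0 ≤ d v := fun v => Nat.cast_nonneg _
  -- sum of squares
  have hsq : (∑ v, d v ^ 2) * μ ≤ 2 ^ k * T * M ^ 2 := by
    have a1 : ∑ v, d v ^ 2 ≤
        ∑ t ∈ (Finset.univ : Finset (Finset α)).filter (fun t => x ∈ t ∧ y ∈ t),
          (NOverlap He n G (t : Set α) : ℝ) := by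
      have h4 := SizeOfLAux.sum_sq_le He n G x y
      have h5 := (Nat.cast_le (α := ℝ)).2 h4
      push_cast at h5
      convert h5
    have a2 : ∀ t ∈ (Finset.univ : Finset (Finset α)).filter (fun t => x ∈ t ∧ y ∈ t),
        (NOverlap He n G (t : Set α) : ℝ) * μ ≤ T * M ^ 2 := by
      intro t ht
      simp only [Finset.mem_filter, Finset.mem_univ, true_and] at ht
      have b1 := h3 (t : Set α)
      have b2 := hFmin (t : Set α) (by simpa using ht.1) (by simpa using ht.2)
      have c1 : (t : Set α).ncard ≤ k := by
        rw [Set.ncard_coe_finset]; exact Finset.card_le_univ t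
      have c2 := SizeOfLAux.eIn_le He (t : Set α)
      calc (NOverlap He n G (t : Set α) : ℝ) * μ
          ≤ (T * (n : ℝ) ^ (2 * k - (t : Set α).ncard) * p ^ (2 * e - eIn He (t : Set α))) *
            ((n : ℝ) ^ ((t : Set α).ncard) * p ^ (eIn He (t : Set α))) := by
            apply mul_le_mul b1 b2 hμ0.le
            positivity
        _ = T * ((n : ℝ) ^ (2 * k - (t : Set α).ncard) * (n : ℝ) ^ ((t : Set α).ncard)) *
            (p ^ (2 * e - eIn He (t : Set α)) * p ^ (eIn He (t : Set α))) := by ring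
        _ = T * M ^ 2 := by
            rw [← pow_add, ← pow_add, Nat.sub_add_cancel (by omega),
              Nat.sub_add_cancel (by omega), hM]
            ring
    calc (∑ v, d v ^ 2) * μ ≤ _ := mul_le_mul_of_nonneg_right a1 hμ0.le
      _ ≤ ((Finset.univ : Finset (Finset α)).filter (fun t => x ∈ t ∧ y ∈ t)).card •
          (T * M ^ 2) := by
        rw [Finset.sum_mul]; exact Finset.sum_le_card_nsmul _ _ _ a2
      _ ≤ 2 ^ k * T * M ^ 2 := by
        rw [nsmul_eq_mul, mul_assoc]
        refine mul_le_mul_of_nonneg_right ?_ (by positivity)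
        have : ((Finset.univ : Finset (Finset α)).filter (fun t => x ∈ t ∧ y ∈ t)).card
            ≤ 2 ^ k := by
          refine (Finset.card_le_univ _).trans ?_
          rw [Fintype.card_finset]
        exact_mod_cast this
  -- L
  have hPpos : (0 : ℝ) < P.ncard := by
    exact_mod_cast (Set.ncard_pos (Set.toFinite _)).2 hPne
  have hLc : (L.ncard : ℝ) = (L.toFinset.card : ℝ) := by
    rw [Set.ncard_eq_toFinset_card']
  have hPc : (P.ncard : ℝ) = (P.toFinset.card : ℝ) := by
    rw [Set.ncard_eq_toFinset_card']
  have hLP : L.toFinset ⊆ P.toFinset := by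
    intro v hv
    rw [Set.mem_toFinset] at hv ⊢
    rw [hL] at hv
    exact hv.1
  have hsumP : ∑ v ∈ P.toFinset, d v = N := by
    rw [← hsum]
    refine Finset.sum_subset (Finset.subset_univ _) fun v _ hv => ?_
    rw [Set.mem_toFinset, hP, Set.mem_ofPred_eq] at hv
    simp only [hd, Nat.cast_eq_zero]
    omega
  have hsmall : ∑ v ∈ P.toFinset \ L.toFinset, d v ≤ N / 2 := by
    have : ∀ v ∈ P.toFinset \ L.toFinset, d v ≤ N / (2 * P.ncard) := by
      intro v hv
      rw [Finset.mem_sdiff, Set.mem_toFinset, Set.mem_toFinset] at hv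
      by_contra hc
      exact hv.2 (by rw [hL]; exact ⟨hv.1, (not_le.1 hc).le⟩)
    have hNn : 0 ≤ N := Nat.cast_nonneg _
    calc _ ≤ _ := Finset.sum_le_card_nsmul _ _ _ this
      _ ≤ (P.ncard : ℝ) * (N / (2 * P.ncard)) := by
        rw [nsmul_eq_mul]
        refine mul_le_mul_of_nonneg_right ?_ (by positivity)
        rw [hPc]
        exact_mod_cast Finset.card_le_card Finset.sdiff_subset
      _ = N / 2 := by field_simp
  have hbig : N / 2 ≤ ∑ v ∈ L.toFinset, d v := by
    have := Finset.sum_sdiff (f := d) hLP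
    linarith
  have hCS : (∑ v ∈ L.toFinset, d v) ^ 2 ≤ (L.ncard : ℝ) * ∑ v, d v ^ 2 := by
    rw [hLc]
    refine sq_sum_le_card_mul_sum_sq.trans ?_
    refine mul_le_mul_of_nonneg_left ?_ (by positivity)
    exact Finset.sum_le_sum_of_subset_of_nonneg (Finset.subset_univ _)
      fun v _ _ => sq_nonneg _
  have hlow : (γ * M / 2) ^ 2 ≤ (∑ v ∈ L.toFinset, d v) ^ 2 := by
    refine pow_le_pow_left₀ (by positivity) ?_ 2
    linarith
  have hfin : (γ * M / 2) ^ 2 * μ ≤ (L.ncard : ℝ) * (2 ^ k * T * M ^ 2) := by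
    calc (γ * M / 2) ^ 2 * μ ≤ ((L.ncard : ℝ) * ∑ v, d v ^ 2) * μ :=
          mul_le_mul_of_nonneg_right (hlow.trans hCS) hμ0.le
      _ = (L.ncard : ℝ) * ((∑ v, d v ^ 2) * μ) := by ring
      _ ≤ _ := mul_le_mul_of_nonneg_left hsq (Nat.cast_nonneg _)
  have hfin2 : M ^ 2 * (γ ^ 2 * μ) ≤ M ^ 2 * ((L.ncard : ℝ) * (2 ^ (k + 2) * T)) := by
    rw [pow_add]
    nlinarith [hfin]
  have hfin3 := le_of_mul_le_mul_left hfin2 (by positivity)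
  rw [mul_assoc, ← hμ, div_mul_eq_mul_div, div_le_iff₀ (by positivity)]
  exact hfin3
end

section
/- Let H be a graph with vertex set {h_1,…,h_k}, let e = {x, y} ∈ E(H), let H_e = H − e, and let J ⊆ H be an induced subgraph not containing both x and y (so J is also an induced subgraph of H_e, and the two images φ(e), φ'(e) of the edge e in H^J are distinct edges, called the (x,y)-edges of H^J). Let G_e ⊆ K_n^{H_e}, let D, θ > 0, let L' ⊆ V_x × V_y satisfy deg_{G_e}(v, H_e^J) < D for every v ∈ L', and let Q ⊆ L'. For a pair e' ∈ L' \ Q, call e' bad if the number of canonical copies of H^J in the graph G_e ∪ Q ∪ {e'} that map one of the two (x,y)-edges of H^J onto e' exceeds θ. Then the number of bad pairs is at most |Q|·D/θ. -/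
open GraphDefs in
/-- bounding the number of bad pairs.  Here `J = H[sJ]` does not
contain both `x` and `y`; a pair `e' ∈ L' \ Q` is bad if the number of canonical
copies of `H^J` in `G_e ∪ Q ∪ {e'}` mapping one of the two `(x,y)`-edges of
`H^J` onto `e'` exceeds `θ`.  The number of bad pairs is at most `|Q|·D/θ`. -/
theorem bad_pairs_bound {α : Type*} [Fintype α] [DecidableEq α]
    (H : SimpleGraph α) (n : ℕ) (x y : α) (hxy : H.Adj x y)
    (He : SimpleGraph α) (hHe : He = H.deleteEdges {s(x, y)})
    (sJ : Set α) (hsJ : ¬ (x ∈ sJ ∧ y ∈ sJ))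
    (Ge : SimpleGraph (α × Fin n)) (hGe : Ge ≤ Kpart He n)
    (D θ : ℝ) (hD : 0 < D) (hθ : 0 < θ)
    (L' : Finset (Fin n × Fin n))
    (hL' : ∀ v ∈ L', (degPairOverlap He n Ge sJ x v.1 y v.2 : ℝ) < D)
    (Q : Finset (Fin n × Fin n)) (hQ : Q ⊆ L') :
    (Set.ncard { e' : Fin n × Fin n | e' ∈ L' ∧ e' ∉ Q ∧
        θ < (Set.ncard { ff ∈ overlapCopies H n
                (addPairs Ge x y (insert e' (↑Q : Set (Fin n × Fin n)))) sJ |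
              (ff.1 x = e'.1 ∧ ff.1 y = e'.2) ∨
              (ff.2 x = e'.1 ∧ ff.2 y = e'.2) } : ℝ) } : ℝ) ≤
      Q.card * D / θ := by
  classical
  subst hHe
  set S : Fin n × Fin n → Set ((α → Fin n) × (α → Fin n)) := fun e' =>
    { ff ∈ overlapCopies H n
                (addPairs Ge x y (insert e' (↑Q : Set (Fin n × Fin n)))) sJ |
              (ff.1 x = e'.1 ∧ ff.1 y = e'.2) ∨
              (ff.2 x = e'.1 ∧ ff.2 y = e'.2) } with hS
  set T : Fin n × Fin n → Set ((α → Fin n) × (α → Fin n)) := fun q =>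
    {ff ∈ overlapCopies (H.deleteEdges {s(x, y)}) n Ge sJ |
      (ff.1 x = q.1 ∨ ff.2 x = q.1) ∧ (ff.1 y = q.2 ∨ ff.2 y = q.2)} with hT
  have hne : x ≠ y := hxy.ne
  have key1 : ∀ (R : Set (Fin n × Fin n)) (f : α → Fin n),
      (∀ a b : α, H.Adj a b → (addPairs Ge x y R).Adj (a, f a) (b, f b)) →
      (f x, f y) ∈ R ∧
      (∀ a b : α, (H.deleteEdges {s(x, y)}).Adj a b → Ge.Adj (a, f a) (b, f b)) := by
    intro R f hf
    constructor
    · have h := hf x y hxy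
      simp only [addPairs, SimpleGraph.sup_adj, SimpleGraph.fromEdgeSet_adj,
        Set.mem_setOf_eq] at h
      rcases h with h | ⟨⟨r, hr, h⟩, -⟩
      · have := hGe h
        simp [Kpart, SimpleGraph.deleteEdges_adj] at this
      · rw [Sym2.eq_iff] at h
        rcases h with ⟨h1, h2⟩ | ⟨h1, h2⟩
        · have e1 := (Prod.ext_iff.1 h1).2
          have e2 := (Prod.ext_iff.1 h2).2
          simp only at e1 e2
          rw [e1, e2]; exact hr
        · exact absurd (Prod.ext_iff.1 h1).1 hne
    · intro a b hab
      rw [SimpleGraph.deleteEdges_adj] at hab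
      have h := hf a b hab.1
      simp only [addPairs, SimpleGraph.sup_adj, SimpleGraph.fromEdgeSet_adj,
        Set.mem_setOf_eq] at h
      rcases h with h | ⟨⟨r, hr, h⟩, -⟩
      · exact h
      · exfalso
        apply hab.2
        have := congrArg (Sym2.map Prod.fst) h
        simpa using this
  have key : ∀ e', e' ∉ Q → ∀ ff ∈ S e',
      ff ∈ overlapCopies (H.deleteEdges {s(x, y)}) n Ge sJ ∧
      (((ff.1 x, ff.1 y) = e' ∧ (ff.2 x, ff.2 y) ∈ Q) ∨
       ((ff.2 x, ff.2 y) = e' ∧ (ff.1 x, ff.1 y) ∈ Q)) := by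
    rintro ⟨e1, e2⟩ he ff ⟨⟨h1, h2, h3, h4⟩, h5⟩
    obtain ⟨m1, g1⟩ := key1 _ _ h1
    obtain ⟨m2, g2⟩ := key1 _ _ h2
    refine ⟨⟨g1, g2, h3, h4⟩, ?_⟩
    have hd : (ff.1 x, ff.1 y) ≠ (ff.2 x, ff.2 y) := by
      intro h
      rw [Prod.mk.injEq] at h
      apply hsJ
      constructor
      · by_contra hx; exact h4 x hx h.1
      · by_contra hy; exact h4 y hy h.2
    rw [Set.mem_insert_iff, Finset.mem_coe] at m1 m2
    rcases h5 with ⟨a, b⟩ | ⟨a, b⟩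
    · left
      have : (ff.1 x, ff.1 y) = (e1, e2) := Prod.ext a b
      refine ⟨this, m2.resolve_left fun h => hd (this.trans h.symm)⟩
    · right
      have : (ff.2 x, ff.2 y) = (e1, e2) := Prod.ext a b
      refine ⟨this, m1.resolve_left fun h => hd (h.trans this.symm)⟩
  set B : Set (Fin n × Fin n) := { e' | e' ∈ L' ∧ e' ∉ Q ∧ θ < ((S e').ncard : ℝ) } with hB
  change (B.ncard : ℝ) ≤ Q.card * D / θ
  rw [le_div_iff₀ hθ]
  have hdis : (B.toFinset : Set (Fin n × Fin n)).PairwiseDisjoint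
      (fun e => (S e).toFinset) := by
    intro e he e' he' hee
    rw [Function.onFun, Finset.disjoint_left]
    intro ff h h'
    rw [Set.mem_toFinset] at h h'
    rw [Finset.mem_coe, Set.mem_toFinset] at he he'
    apply hee
    rcases (key e he.2.1 ff h).2 with ⟨a, b⟩ | ⟨a, b⟩ <;>
      rcases (key e' he'.2.1 ff h').2 with ⟨a', b'⟩ | ⟨a', b'⟩
    · exact a.symm.trans a'
    · exact absurd (a ▸ b') he.2.1
    · exact absurd (a ▸ b') he.2.1
    · exact a.symm.trans a'
  have hsub : B.toFinset.biUnion (fun e => (S e).toFinset) ⊆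
      Q.biUnion (fun q => (T q).toFinset) := by
    intro ff h
    simp only [Finset.mem_biUnion, Set.mem_toFinset] at h ⊢
    obtain ⟨e, he, h⟩ := h
    obtain ⟨h1, h2⟩ := key e he.2.1 ff h
    rcases h2 with ⟨_, h2⟩ | ⟨_, h2⟩
    · exact ⟨_, h2, h1, Or.inr rfl, Or.inr rfl⟩
    · exact ⟨_, h2, h1, Or.inl rfl, Or.inl rfl⟩
  have hcard := (Finset.card_biUnion hdis).symm.trans_le
    ((Finset.card_le_card hsub).trans Finset.card_biUnion_le)
  have hlow : (B.ncard : ℝ) * θ ≤ ∑ e ∈ B.toFinset, ((S e).toFinset.card : ℝ) := by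
    rw [Set.ncard_eq_toFinset_card' B, ← nsmul_eq_mul]
    apply Finset.card_nsmul_le_sum
    intro e he
    rw [Set.mem_toFinset] at he
    rw [← Set.ncard_eq_toFinset_card']
    exact he.2.2.le
  have hup : ∑ q ∈ Q, ((T q).toFinset.card : ℝ) ≤ Q.card * D := by
    rw [← nsmul_eq_mul]
    apply Finset.sum_le_card_nsmul
    intro q hq
    rw [← Set.ncard_eq_toFinset_card']
    exact (hL' q (hQ hq)).le
  have hmid : ∑ e ∈ B.toFinset, ((S e).toFinset.card : ℝ) ≤
      ∑ q ∈ Q, ((T q).toFinset.card : ℝ) := by exact_mod_cast hcard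
  linarith
end

section
/- Let H be a graph with vertex set {h_1,…,h_k}, let e = {x, y} ∈ E(H), let H_e = H − e, and let J ⊆ H be an induced subgraph with x, y ∈ V(J) (so that the two copies of H in H^J share the edge {x,y}, which is the unique edge of H^J between a J-vertex position x and position y); let J' = J − {x,y}, an induced subgraph of H_e, so that H_e^{J'} is H^J with the edge {x,y} removed. Then for every G_e ⊆ K_n^{H_e} and every Q ⊆ V_x × V_y, letting G = G_e ∪ Q, every canonical copy of H^J in G uses exactly one edge of Q, and N_G(H^J) = ∑_{q ∈ Q} deg_{G_e}(q, H_e^{J'}). -/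
open GraphDefs in
theorem aux_copy_iff {α : Type*} [Fintype α] [DecidableEq α]
    (H : SimpleGraph α) (n : ℕ) (x y : α) (hxy : H.Adj x y)
    (Ge : SimpleGraph (α × Fin n)) (hGe : Ge ≤ Kpart (H.deleteEdges {s(x, y)}) n)
    (Q : Finset (Fin n × Fin n)) (f : α → Fin n) :
    (∀ a b : α, H.Adj a b → (addPairs Ge x y ↑Q).Adj (a, f a) (b, f b)) ↔
    ((∀ a b : α, (H.deleteEdges {s(x, y)}).Adj a b → Ge.Adj (a, f a) (b, f b)) ∧
      (f x, f y) ∈ Q) := by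
  have hne : x ≠ y := hxy.ne
  have key : ∀ a b, (addPairs Ge x y ↑Q).Adj (a, f a) (b, f b) ↔
      (Ge.Adj (a, f a) (b, f b) ∨ ((f x, f y) ∈ Q ∧ s(a, b) = s(x, y))) := by
    intro a b
    simp only [addPairs, SimpleGraph.sup_adj, SimpleGraph.fromEdgeSet_adj, Set.mem_setOf_eq,
      Sym2.eq_iff, Prod.mk.injEq, Finset.mem_coe, Prod.exists, ne_eq]
    refine or_congr_right ?_
    constructor
    · rintro ⟨⟨u, w, hq, h⟩, -⟩
      rcases h with ⟨⟨rfl, rfl⟩, rfl, rfl⟩ | ⟨⟨rfl, rfl⟩, rfl, rfl⟩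
      · exact ⟨hq, by simp⟩
      · exact ⟨hq, by simp⟩
    · rintro ⟨hq, ⟨rfl, rfl⟩ | ⟨rfl, rfl⟩⟩
      · exact ⟨⟨_, _, hq, by simp⟩, fun h => hne h.1⟩
      · exact ⟨⟨_, _, hq, by simp⟩, fun h => hne h.1.symm⟩
  simp only [key, SimpleGraph.deleteEdges_adj, Set.mem_singleton_iff]
  constructor
  · intro h
    refine ⟨fun a b hab => ?_, ?_⟩
    · rcases h a b hab.1 with h1 | h1
      · exact h1
      · exact absurd h1.2 hab.2
    · rcases h x y hxy with h1 | h1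
      · have := hGe h1
        simp [Kpart] at this
      · exact h1.1
  · rintro ⟨h, hq⟩ a b hab
    by_cases hs : s(a, b) = s(x, y)
    · exact Or.inr ⟨hq, hs⟩
    · exact Or.inl (h a b ⟨hab, hs⟩)

open GraphDefs in
/-- for an induced subgraph `J = H[t]` with `x, y ∈ t`, in
`G = G_e ∪ Q` every canonical copy of `H^J` uses exactly one edge of `Q`, and
`N_G(H^J) = ∑_{q ∈ Q} deg_{G_e}(q, H_e^{J'})` where `J' = J − {x,y} = H_e[t]`. -/
theorem overlap_copies_through_Q {α : Type*} [Fintype α] [DecidableEq α]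
    (H : SimpleGraph α) (n : ℕ) (x y : α) (hxy : H.Adj x y)
    (He : SimpleGraph α) (hHe : He = H.deleteEdges {s(x, y)})
    (t : Set α) (hx : x ∈ t) (hy : y ∈ t)
    (Ge : SimpleGraph (α × Fin n)) (hGe : Ge ≤ Kpart He n)
    (Q : Finset (Fin n × Fin n)) :
    (∀ ff ∈ overlapCopies H n (addPairs Ge x y ↑Q) t,
        ∃! q : Fin n × Fin n, q ∈ Q ∧ ff.1 x = q.1 ∧ ff.1 y = q.2) ∧
    NOverlap H n (addPairs Ge x y ↑Q) t =
      ∑ q ∈ Q, degPairOverlap He n Ge t x q.1 y q.2 := by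
  subst hHe
  have key := aux_copy_iff H n x y hxy Ge hGe Q
  have hmem : ∀ ff, ff ∈ overlapCopies H n (addPairs Ge x y ↑Q) t ↔
      (ff ∈ overlapCopies (H.deleteEdges {s(x, y)}) n Ge t ∧ (ff.1 x, ff.1 y) ∈ Q) := by
    intro ff
    unfold overlapCopies
    simp only [Set.mem_setOf_eq, key]
    constructor
    · rintro ⟨⟨h1, h2⟩, ⟨h3, h4⟩, h5, h6⟩
      exact ⟨⟨h1, h3, h5, h6⟩, h2⟩
    · rintro ⟨⟨h1, h3, h5, h6⟩, h2⟩
      exact ⟨⟨h1, h2⟩, ⟨h3, by rw [← h5 x hx, ← h5 y hy]; exact h2⟩, h5, h6⟩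
  refine ⟨fun ff hff => ⟨(ff.1 x, ff.1 y), ⟨((hmem ff).1 hff).2, rfl, rfl⟩, ?_⟩, ?_⟩
  · rintro ⟨u, w⟩ ⟨-, h1, h2⟩
    exact Prod.ext h1.symm h2.symm
  · classical
    unfold NOverlap degPairOverlap
    rw [Set.ncard_eq_toFinset_card _ (Set.toFinite _),
      Finset.card_eq_sum_card_fiberwise (f := fun ff => (ff.1 x, ff.1 y)) (t := Q)]
    · refine Finset.sum_congr rfl fun q hq => ?_
      rw [Set.ncard_eq_toFinset_card _ (Set.toFinite _)]
      congr 1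
      ext ff
      simp only [Finset.mem_filter, Set.Finite.mem_toFinset, hmem, Set.mem_setOf_eq]
      constructor
      · rintro ⟨⟨h1, -⟩, rfl⟩
        exact ⟨h1, Or.inl rfl, Or.inl rfl⟩
      · rintro ⟨h1, h2, h3⟩
        have e : (ff.1 x, ff.1 y) = q := by
          rw [← h1.2.2.1 x hx, or_self] at h2
          rw [← h1.2.2.1 y hy, or_self] at h3
          exact Prod.ext h2 h3
        exact ⟨⟨h1, e ▸ hq⟩, e⟩
    · intro ff hff
      simp only [Finset.mem_coe, Set.Finite.mem_toFinset] at hff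
      exact ((hmem ff).1 hff).2
end

section
/- Let H be a graph with vertex set {h_1,…,h_k} and at least two edges, let e = {x, y} ∈ E(H), and let H_e = H − e. Let γ, T > 0, let b ≥ 1 be an integer, set p = 1/b, and let G_e ⊆ K_n^{H_e} satisfy: N_{G_e}(H_e) ≥ γ·n^{v(H_e)}·p^{e(H_e)}; N_{G_e}(H') ≤ T·n^{v(H')}·p^{e(H')} for every induced subgraph H' ⊆ H_e; and N_{G_e}(H_e^J) ≤ T·n^{2v(H_e)−v(J)}·p^{2e(H_e)−e(J)} for every induced subgraph J ⊆ H_e. Let P ⊆ V_x × V_y be the set of pairs v with deg_{G_e}(v, H_e) ≥ 1, assume P is nonempty, and let L = { v ∈ P : deg_{G_e}(v, H_e) ≥ N_{G_e}(H_e)/(2|P|) }. Then for every Q ⊆ L with |Q| ≥ |L|/(4b), the graph G = G_e ∪ Q satisfies N_G(H) ≥ (γ³/(2^{v(H)+6}·T²))·n^{v(H)}·p^{e(H)}. -/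
open GraphDefs in
lemma aux_eIn {α : Type*} [Fintype α] [DecidableEq α]
    (H : SimpleGraph α) (x y : α) (hxy : H.Adj x y) :
    eIn H Set.univ = eIn (H.deleteEdges {s(x, y)}) Set.univ + 1 := by
  classical
  unfold eIn
  simp only [Set.mem_univ, implies_true, and_true, Set.setOf_mem_eq]
  rw [SimpleGraph.edgeSet_deleteEdges]
  exact (Set.ncard_sdiff_singleton_add_one (by simpa using hxy) (Set.toFinite _)).symm

open GraphDefs in
lemma aux_eIn_le {α : Type*} [Fintype α] [DecidableEq α]
    (H : SimpleGraph α) (t : Set α) : eIn H t ≤ eIn H Set.univ := by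
  classical
  unfold eIn
  refine Set.ncard_le_ncard ?_ (Set.toFinite _)
  intro e he
  exact ⟨he.1, fun _ _ => Set.mem_univ _⟩

/-- Copies as functions on the full vertex set. -/
noncomputable def cop {α : Type*} [Fintype α] [DecidableEq α]
    (H : SimpleGraph α) (n : ℕ) (G : SimpleGraph (α × Fin n)) : Finset (α → Fin n) :=
  (Set.toFinite {f : α → Fin n | ∀ a b, H.Adj a b → G.Adj (a, f a) (b, f b)}).toFinset

lemma mem_cop {α : Type*} [Fintype α] [DecidableEq α]
    (H : SimpleGraph α) (n : ℕ) (G : SimpleGraph (α × Fin n)) (f : α → Fin n) :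
    f ∈ cop H n G ↔ ∀ a b, H.Adj a b → G.Adj (a, f a) (b, f b) := by
  simp [cop]

open GraphDefs in
lemma ncopies_univ {α : Type*} [Fintype α] [DecidableEq α]
    (H : SimpleGraph α) (n : ℕ) (G : SimpleGraph (α × Fin n)) :
    NCopies H n G Set.univ = (cop H n G).card := by
  classical
  unfold NCopies
  rw [← Set.ncard_coe_finset]
  refine Set.ncard_congr (fun f _ => fun a => f ⟨a, Set.mem_univ a⟩) ?_ ?_ ?_
  · intro f hf
    simp only [Finset.mem_coe, mem_cop]
    intro a b hab
    exact hf ⟨a, Set.mem_univ a⟩ ⟨b, Set.mem_univ b⟩ hab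
  · intro f g _ _ h
    funext a
    exact congrFun h a.1
  · intro f hf
    simp only [Finset.mem_coe, mem_cop] at hf
    exact ⟨fun a => f a.1, fun a b hab => hf _ _ hab, rfl⟩

open GraphDefs in
lemma degPair_univ {α : Type*} [Fintype α] [DecidableEq α]
    (H : SimpleGraph α) (n : ℕ) (G : SimpleGraph (α × Fin n)) (x y : α) (v : Fin n × Fin n) :
    degPair H n G Set.univ x v.1 y v.2 =
      ((cop H n G).filter (fun f => (f x, f y) = v)).card := by
  classical
  unfold degPair
  rw [← Set.ncard_coe_finset]
  refine Set.ncard_congr (fun f _ => fun a => f ⟨a, Set.mem_univ a⟩) ?_ ?_ ?_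
  · rintro f ⟨hf, ⟨⟨a, _⟩, rfl, h1⟩, ⟨⟨a', _⟩, rfl, h2⟩⟩
    simp only [Finset.coe_filter, Set.mem_setOf_eq, mem_cop]
    refine ⟨?_, Prod.ext h1 h2⟩
    intro a b hab
    exact hf ⟨a, Set.mem_univ a⟩ ⟨b, Set.mem_univ b⟩ hab
  · intro f g _ _ h
    funext a
    exact congrFun h a.1
  · intro f hf
    simp only [Finset.coe_filter, Set.mem_setOf_eq, mem_cop] at hf
    obtain ⟨hf, rfl⟩ := hf
    exact ⟨fun a => f a.1, ⟨fun a b hab => hf _ _ hab,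
      ⟨⟨x, Set.mem_univ x⟩, rfl, rfl⟩, ⟨⟨y, Set.mem_univ y⟩, rfl, rfl⟩⟩, rfl⟩

open GraphDefs in
lemma image_le {α : Type*} [Fintype α] [DecidableEq α]
    (H : SimpleGraph α) (n : ℕ) (G : SimpleGraph (α × Fin n)) (x y : α)
    (t : Set α) (hx : x ∈ t) (hy : y ∈ t) :
    ((cop H n G).image (fun f => (f x, f y))).card ≤ NCopies H n G t := by
  classical
  unfold NCopies
  rw [← Set.ncard_coe_finset]
  refine le_trans (Set.ncard_le_ncard ?_ (Set.toFinite _))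
    (Set.ncard_image_le (f := fun g : t → Fin n => (g ⟨x, hx⟩, g ⟨y, hy⟩)) (Set.toFinite _))
  intro v hv
  simp only [Finset.coe_image, Set.mem_image, Finset.mem_coe, mem_cop] at hv
  obtain ⟨f, hf, rfl⟩ := hv
  exact ⟨fun a => f a.1, fun a b hab => hf _ _ hab, rfl⟩

open GraphDefs in
lemma pairs_le {α : Type*} [Fintype α] [DecidableEq α]
    (H : SimpleGraph α) (n : ℕ) (G : SimpleGraph (α × Fin n)) (x y : α) (M : ℕ) (R : ℝ)
    (hR : 0 ≤ R)
    (h : ∀ t : Set α, x ∈ t → y ∈ t → (M : ℝ) * NOverlap H n G t ≤ R) :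
    (M : ℝ) * ((((cop H n G) ×ˢ (cop H n G)).filter
      (fun ff => (ff.1 x, ff.1 y) = (ff.2 x, ff.2 y))).card : ℝ) ≤
      2 ^ (Fintype.card α) * R := by
  classical
  set D := ((cop H n G) ×ˢ (cop H n G)).filter
      (fun ff => (ff.1 x, ff.1 y) = (ff.2 x, ff.2 y)) with hD
  set φ : (α → Fin n) × (α → Fin n) → Finset α :=
    fun ff => Finset.univ.filter (fun a => ff.1 a = ff.2 a) with hφ
  have hcard : D.card = ∑ t : Finset α, (D.filter (fun ff => φ ff = t)).card :=
    Finset.card_eq_sum_card_fiberwise (fun _ _ => Finset.mem_coe.2 (Finset.mem_univ _))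
  have key : ∀ t : Finset α, (M : ℝ) * ((D.filter (fun ff => φ ff = t)).card : ℝ) ≤ R := by
    intro t
    by_cases ht : x ∈ t ∧ y ∈ t
    · refine le_trans ?_ (h (t : Set α) (by simpa using ht.1) (by simpa using ht.2))
      gcongr
      unfold NOverlap
      rw [← Set.ncard_coe_finset]
      refine Set.ncard_le_ncard ?_ (Set.toFinite _)
      intro ff hff
      simp only [hD, Finset.coe_filter, Finset.mem_filter, Finset.mem_product, mem_cop,
        Set.mem_setOf_eq] at hff
      obtain ⟨⟨⟨h1, h2⟩, _⟩, rfl⟩ := hff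
      refine ⟨h1, h2, ?_, ?_⟩
      · intro a ha
        simpa [hφ] using ha
      · intro a ha
        simpa [hφ] using ha
    · have : D.filter (fun ff => φ ff = t) = ∅ := by
        rw [Finset.filter_eq_empty_iff]
        rintro ff hff rfl
        apply ht
        simp only [hD, Finset.mem_filter, Prod.mk.injEq] at hff
        simpa [hφ] using hff.2
      rw [this]
      simpa using hR
  rw [hcard]
  push_cast
  rw [Finset.mul_sum]
  refine le_trans (Finset.sum_le_sum (fun t _ => key t)) ?_
  simp

open GraphDefs in
lemma newcopies_ge {α : Type*} [Fintype α] [DecidableEq α]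
    (H : SimpleGraph α) (n : ℕ) (G : SimpleGraph (α × Fin n)) (x y : α) (hxy : H.Adj x y)
    (Q : Finset (Fin n × Fin n)) :
    ∑ v ∈ Q, ((cop (H.deleteEdges {s(x, y)}) n G).filter (fun f => (f x, f y) = v)).card ≤
      NCopies H n (addPairs G x y ↑Q) Set.univ := by
  classical
  rw [ncopies_univ, ← Finset.card_biUnion]
  · apply Finset.card_le_card
    intro f hf
    simp only [Finset.mem_biUnion, Finset.mem_filter, mem_cop] at hf ⊢
    obtain ⟨v, hv, hf, rfl⟩ := hf
    intro a b hab
    by_cases hs : s(a, b) = s(x, y)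
    · right
      rw [SimpleGraph.fromEdgeSet_adj]
      refine ⟨⟨_, hv, ?_⟩, ?_⟩
      · have := congrArg (Sym2.map (fun a => (a, f a))) hs
        simpa using this
      · intro h
        exact hab.ne (Prod.ext_iff.1 h).1
    · left
      apply hf
      rw [SimpleGraph.deleteEdges_adj]
      exact ⟨hab, hs⟩
  · intro v _ w _ hvw
    rw [Function.onFun, Finset.disjoint_left]
    intro f hf hg
    simp only [Finset.mem_filter] at hf hg
    exact hvw (hf.2.symm.trans hg.2)

lemma sum_sq_fiber {β δ : Type*} [DecidableEq β] [DecidableEq δ] (A : Finset β) (π : β → δ) (L : Finset δ) :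
    ∑ v ∈ L, (A.filter (fun f => π f = v)).card ^ 2 ≤
      ((A ×ˢ A).filter (fun ff => π ff.1 = π ff.2)).card := by
  classical
  calc ∑ v ∈ L, (A.filter (fun f => π f = v)).card ^ 2
      = ∑ v ∈ L, ((A.filter (fun f => π f = v)) ×ˢ (A.filter (fun f => π f = v))).card := by
        simp [Finset.card_product, sq]
    _ = (L.biUnion fun v =>
        ((A.filter (fun f => π f = v)) ×ˢ (A.filter (fun f => π f = v)))).card := by
        rw [Finset.card_biUnion]
        intro v _ w _ hvw
        rw [Function.onFun, Finset.disjoint_left]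
        intro f hf hg
        simp only [Finset.mem_filter, Finset.mem_product] at hf hg
        exact hvw (hf.1.2.symm.trans hg.1.2)
    _ ≤ _ := by
        apply Finset.card_le_card
        intro f hf
        simp only [Finset.mem_biUnion, Finset.mem_filter, Finset.mem_product] at hf ⊢
        obtain ⟨v, _, ⟨h1, h2⟩, h3, h4⟩ := hf
        exact ⟨⟨h1, h3⟩, h2.trans h4.symm⟩

lemma final_arith (γ T N M D l q X NG p b : ℝ) (k : ℕ) (hγ : 0 < γ) (hT : 0 < T)
    (hb : 0 < b) (hp : p = 1 / b) (hM : 0 < M) (hX : 0 < X)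
    (hN : γ * X ≤ N) (hD : 0 ≤ D) (hl : 0 ≤ l) (hlD : (N / 2) ^ 2 ≤ l * D)
    (hMD : M * D ≤ 2 ^ k * (T ^ 2 * X ^ 2))
    (hq : l / (4 * b) ≤ q) (hNG : q * (N / (2 * M)) ≤ NG) :
    γ ^ 3 / (2 ^ (k + 6) * T ^ 2) * (X * p) ≤ NG := by
  have hNpos : 0 < N := lt_of_lt_of_le (by positivity) hN
  -- ratio bound
  have h1 : γ ^ 2 * M ≤ 4 * (2 ^ k * T ^ 2) * l := by
    have hDpos : 0 < D := by
      rcases hD.lt_or_eq with h | h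
      · exact h
      · rw [← h] at hlD
        nlinarith [sq_pos_of_pos hNpos]
    have h2 : (γ * X) ^ 2 ≤ 4 * (l * D) := by
      have := pow_le_pow_left₀ (by positivity) hN 2
      nlinarith
    have h3 : (γ * X) ^ 2 * M ≤ 4 * l * (2 ^ k * (T ^ 2 * X ^ 2)) := by
      calc (γ * X) ^ 2 * M ≤ 4 * (l * D) * M := by gcongr
        _ = 4 * l * (M * D) := by ring
        _ ≤ _ := by gcongr
    have hX2 : 0 < X ^ 2 := by positivity
    refine le_of_mul_le_mul_right ?_ hX2
    calc γ ^ 2 * M * X ^ 2 = (γ * X) ^ 2 * M := by ring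
      _ ≤ _ := h3
      _ = _ := by ring
  have h4 : l / (4 * b) * (γ * X / (2 * M)) ≤ NG := by
    refine le_trans ?_ hNG
    gcongr
    exact le_trans (by positivity) hq
  refine le_trans ?_ h4
  subst hp
  have e1 : γ ^ 3 / (2 ^ (k + 6) * T ^ 2) * (X * (1 / b)) =
      (γ * X / (8 * b * M)) * (γ ^ 2 * M / (8 * 2 ^ k * T ^ 2)) := by
    rw [pow_add]; field_simp; norm_num
  have e2 : l / (4 * b) * (γ * X / (2 * M)) = (γ * X / (8 * b * M)) * l := by
    field_simp; ring
  rw [e1, e2]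
  gcongr
  rw [div_le_iff₀ (by positivity)]
  have : 0 ≤ 2 ^ k * T ^ 2 * l := by positivity
  nlinarith

open GraphDefs in
/-- if `G_e ⊆ K_n^{H_e}` satisfies (P1)–(P3) for `H_e = H − {x,y}`
and `Q ⊆ L` has size at least `|L|/(4b)`, then `G = G_e ∪ Q` satisfies
`N_G(H) ≥ (γ³/(2^(v(H)+6)·T²))·n^(v(H))·p^(e(H))`. -/
theorem induction_step_P1 {α : Type*} [Fintype α] [DecidableEq α]
    (H : SimpleGraph α) (hsize : 2 ≤ H.edgeSet.ncard) (n : ℕ)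
    (x y : α) (hxy : H.Adj x y)
    (He : SimpleGraph α) (hHe : He = H.deleteEdges {s(x, y)})
    (γ T : ℝ) (hγ : 0 < γ) (hT : 0 < T)
    (b : ℕ) (hb : 1 ≤ b) (p : ℝ) (hp : p = 1 / b)
    (Ge : SimpleGraph (α × Fin n)) (hGe : Ge ≤ Kpart He n)
    (h1 : γ * (n : ℝ) ^ (Fintype.card α) * p ^ (eIn He Set.univ) ≤
      (NCopies He n Ge Set.univ : ℝ))
    (h2 : ∀ t : Set α, (NCopies He n Ge t : ℝ) ≤ T * (n : ℝ) ^ (t.ncard) * p ^ (eIn He t))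
    (h3 : ∀ t : Set α, (NOverlap He n Ge t : ℝ) ≤
      T * (n : ℝ) ^ (2 * Fintype.card α - t.ncard) * p ^ (2 * eIn He Set.univ - eIn He t))
    (P L : Set (Fin n × Fin n))
    (hP : P = { v | 1 ≤ degPair He n Ge Set.univ x v.1 y v.2 })
    (hPne : P.Nonempty)
    (hL : L = { v ∈ P | (NCopies He n Ge Set.univ : ℝ) / (2 * P.ncard) ≤
                  (degPair He n Ge Set.univ x v.1 y v.2 : ℝ) })
    (Q : Finset (Fin n × Fin n)) (hQL : ↑Q ⊆ L)
    (hQcard : (L.ncard : ℝ) / (4 * b) ≤ (Q.card : ℝ)) :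
    γ ^ 3 / (2 ^ (Fintype.card α + 6) * T ^ 2) * (n : ℝ) ^ (Fintype.card α) *
        p ^ (eIn H Set.univ) ≤
      (NCopies H n (addPairs Ge x y ↑Q) Set.univ : ℝ) := by
  classical
  subst hHe
  set He := H.deleteEdges {s(x, y)} with hHe
  set A := cop He n Ge with hA
  set d : Fin n × Fin n → ℕ := fun v => (A.filter (fun f => (f x, f y) = v)).card with hd
  set Pf := A.image (fun f => (f x, f y)) with hPf
  have hdeg : ∀ v : Fin n × Fin n, degPair He n Ge Set.univ x v.1 y v.2 = d v :=
    fun v => degPair_univ He n Ge x y v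
  have hPP : P = (Pf : Set (Fin n × Fin n)) := by
    rw [hP]
    ext v
    simp only [Set.mem_setOf_eq, hdeg, hd, Nat.one_le_iff_ne_zero, Finset.card_ne_zero, hPf,
      Finset.coe_image, Set.mem_image, Finset.mem_coe]
    constructor
    · rintro ⟨f, hf⟩
      exact ⟨f, (Finset.mem_filter.1 hf).1, (Finset.mem_filter.1 hf).2⟩
    · rintro ⟨f, hf, hv⟩
      exact ⟨f, Finset.mem_filter.2 ⟨hf, hv⟩⟩
  have hPc : P.ncard = Pf.card := by rw [hPP, Set.ncard_coe_finset]
  have hMpos : 0 < Pf.card := by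
    rw [Finset.card_pos]
    rw [hPP] at hPne
    exact_mod_cast hPne
  have hn : 0 < n := by
    obtain ⟨v, _⟩ := hPne
    exact v.1.pos
  have hNA : NCopies He n Ge Set.univ = A.card := ncopies_univ He n Ge
  rw [hNA] at h1 hL
  rw [hPc] at hL
  set Lf := Pf.filter (fun v => (A.card : ℝ) / (2 * Pf.card) ≤ (d v : ℝ)) with hLf
  have hLL : L = (Lf : Set (Fin n × Fin n)) := by
    rw [hL, hPP]
    ext v
    simp [hLf, hdeg]
  have hLc : L.ncard = Lf.card := by rw [hLL, Set.ncard_coe_finset]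
  rw [hLc] at hQcard
  have hQL' : Q ⊆ Lf := by
    rw [hLL] at hQL
    exact_mod_cast hQL
  have hbpos : (0 : ℝ) < b := by exact_mod_cast hb
  have hppos : 0 < p := by rw [hp]; positivity
  have hnpos : (0 : ℝ) < n := by exact_mod_cast hn
  have hMR : (0 : ℝ) < Pf.card := by exact_mod_cast hMpos
  have hsumP : (A.card : ℝ) = ∑ v ∈ Pf, (d v : ℝ) := by
    have : A.card = ∑ v ∈ Pf, d v :=
      Finset.card_eq_sum_card_image (fun f => (f x, f y)) A
    exact_mod_cast this
  have hsumL : (A.card : ℝ) / 2 ≤ ∑ v ∈ Lf, (d v : ℝ) := by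
    have hsplit := Finset.sum_filter_add_sum_filter_not Pf
      (fun v => (A.card : ℝ) / (2 * Pf.card) ≤ (d v : ℝ)) (fun v => (d v : ℝ))
    have hsmall : ∑ v ∈ Pf.filter (fun v => ¬ (A.card : ℝ) / (2 * Pf.card) ≤ (d v : ℝ)),
        (d v : ℝ) ≤ (A.card : ℝ) / 2 := by
      calc _ ≤ ∑ v ∈ Pf.filter (fun v => ¬ (A.card : ℝ) / (2 * Pf.card) ≤ (d v : ℝ)),
              (A.card : ℝ) / (2 * Pf.card) := by
            apply Finset.sum_le_sum
            intro v hv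
            exact (not_le.1 (Finset.mem_filter.1 hv).2).le
        _ ≤ ∑ v ∈ Pf, (A.card : ℝ) / (2 * Pf.card) := by
            apply Finset.sum_le_sum_of_subset_of_nonneg (Finset.filter_subset _ _)
            intros
            positivity
        _ = (A.card : ℝ) / 2 := by
            rw [Finset.sum_const, nsmul_eq_mul]
            field_simp
    rw [← hsumP] at hsplit
    linarith
  set D := ((A ×ˢ A).filter (fun ff => (ff.1 x, ff.1 y) = (ff.2 x, ff.2 y))).card with hD
  have hsq : ∑ v ∈ Lf, (d v : ℝ) ^ 2 ≤ (D : ℝ) := by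
    have := sum_sq_fiber A (fun f => (f x, f y)) Lf
    exact_mod_cast this
  have hlD : ((A.card : ℝ) / 2) ^ 2 ≤ (Lf.card : ℝ) * D := by
    calc ((A.card : ℝ) / 2) ^ 2 ≤ (∑ v ∈ Lf, (d v : ℝ)) ^ 2 := by gcongr
      _ ≤ Lf.card * ∑ v ∈ Lf, (d v : ℝ) ^ 2 := sq_sum_le_card_mul_sum_sq
      _ ≤ _ := by gcongr
  set X : ℝ := (n : ℝ) ^ (Fintype.card α) * p ^ (eIn He Set.univ) with hX
  have hXpos : 0 < X := by positivity
  have hMD : (Pf.card : ℝ) * D ≤ 2 ^ (Fintype.card α) * (T ^ 2 * X ^ 2) := by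
    refine pairs_le He n Ge x y Pf.card (T ^ 2 * X ^ 2) (by positivity) ?_
    intro t hx hy
    have hM1 : (Pf.card : ℝ) ≤ NCopies He n Ge t := by
      exact_mod_cast image_le He n Ge x y t hx hy
    have htc : t.ncard ≤ Fintype.card α := by
      rw [← Nat.card_eq_fintype_card]
      exact Set.ncard_le_card t
    have hte := aux_eIn_le He t
    calc (Pf.card : ℝ) * NOverlap He n Ge t
        ≤ (T * (n : ℝ) ^ (t.ncard) * p ^ (eIn He t)) *
          (T * (n : ℝ) ^ (2 * Fintype.card α - t.ncard) *
            p ^ (2 * eIn He Set.univ - eIn He t)) := by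
          have := hM1.trans (h2 t)
          have := h3 t
          gcongr
      _ = T ^ 2 * ((n : ℝ) ^ (t.ncard + (2 * Fintype.card α - t.ncard)) *
            p ^ (eIn He t + (2 * eIn He Set.univ - eIn He t))) := by
          rw [pow_add, pow_add]; ring
      _ = T ^ 2 * X ^ 2 := by
          rw [Nat.add_sub_cancel' (by omega), Nat.add_sub_cancel' (by omega), hX]
          ring
  have hNG : (Q.card : ℝ) * ((A.card : ℝ) / (2 * Pf.card)) ≤
      (NCopies H n (addPairs Ge x y ↑Q) Set.univ : ℝ) := by
    have h5 : ((∑ v ∈ Q, d v : ℕ) : ℝ) ≤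
        (NCopies H n (addPairs Ge x y ↑Q) Set.univ : ℝ) := by
      exact_mod_cast newcopies_ge H n Ge x y hxy Q
    refine le_trans ?_ h5
    push_cast
    rw [← nsmul_eq_mul]
    apply Finset.card_nsmul_le_sum
    intro v hv
    exact (Finset.mem_filter.1 (hQL' hv)).2
  have hfin := final_arith γ T A.card Pf.card D Lf.card Q.card X _ p b (Fintype.card α) hγ hT
    hbpos hp hMR hXpos (by rw [hX, ← mul_assoc]; exact h1) (Nat.cast_nonneg _)
    (Nat.cast_nonneg _) hlD hMD hQcard hNG
  refine le_trans (le_of_eq ?_) hfin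
  rw [aux_eIn H x y hxy, pow_succ, hX]
  ring
end
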